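/- Stability of the upwind convection operator: there exists a constant C > 0 depending only on Ω and the mesh-regularity constant C_reg such that for every admissible regular triangulation 𝒯_h of Ω, every u_h ∈ RT₀ with div(u_h|_K) = 0 on every triangle K, and all v_h, w_h ∈ P₀: |b_h(u_h, v_h, w_h)| ≤ C |u_h| ‖v_h‖_h ‖w_h‖_h, where |u_h| is the L²(Ω) norm. -/

import Mathlib

open scoped RealInnerProductSpace
open MeasureTheory

attribute [local instance] Classical.propDecidable

noncomputable section

/-- The Euclidean plane. -/
abbrev E2 : Type := EuclideanSpace ℝ (Fin 2)

/-- A nondegenerate (closed) triangle of the plane, given by its three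
affinely independent vertices. -/
structure Tri : Type where
  vtx : Fin 3 → E2
  indep : AffineIndependent ℝ vtx

namespace Tri

/-- The triangle as a subset of the plane: the convex hull of its vertices. -/
def carrier (t : Tri) : Set E2 := convexHull ℝ (Set.range t.vtx)

/-- The area `|K|` of the triangle. -/
def area (t : Tri) : ℝ := (volume t.carrier).toReal

/-- The centroid of the triangle. -/
def centroid (t : Tri) : E2 := Finset.centroid ℝ Finset.univ t.vtx

/-- The triangle seen as a 2-simplex. -/
def simplex (t : Tri) : Affine.Simplex ℝ E2 2 := ⟨t.vtx, t.indep⟩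

/-- The circumcenter `x_K` of the triangle. -/
def ccenter (t : Tri) : E2 := t.simplex.circumcenter

/-- `σ` (an ordered pair of distinct points) is an edge of the triangle `t`:
both of its endpoints are vertices of `t`. -/
def hasEdge (t : Tri) (σ : E2 × E2) : Prop :=
  σ.1 ≠ σ.2 ∧ σ.1 ∈ Set.range t.vtx ∧ σ.2 ∈ Set.range t.vtx

end Tri

/-- The segment of an edge. -/
def eseg (σ : E2 × E2) : Set E2 := segment ℝ σ.1 σ.2

/-- The length `|σ|` of an edge. -/
def elen (σ : E2 × E2) : ℝ := dist σ.1 σ.2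

/-- The midpoint `x_σ` of an edge. -/
def emid (σ : E2 × E2) : E2 := midpoint ℝ σ.1 σ.2

/-- Rotation by `π/2` in the plane. -/
def perp (x : E2) : E2 := (EuclideanSpace.equiv (Fin 2) ℝ).symm ![-(x 1), x 0]

/-- The unit normal `n_{K,σ}` to the edge `σ`, pointing outward of the triangle `t`. -/
def Tri.nrm (t : Tri) (σ : E2 × E2) : E2 :=
  if 0 ≤ ⟪perp (σ.2 - σ.1), emid σ - t.centroid⟫
  then (elen σ)⁻¹ • perp (σ.2 - σ.1)
  else -((elen σ)⁻¹ • perp (σ.2 - σ.1))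

/-- An admissible triangulation `𝒯_h` of `Ω`, together with a registration of its
edges (each geometric edge is recorded once, with a chosen orientation) and a labelling
`K_σ`, `L_σ` of the triangle(s) adjacent to each edge.  All interior angles of all
triangles are `< π/2`. -/
structure Mesh (Ω : Set E2) : Type where
  tris : Finset Tri
  tris_nonempty : tris.Nonempty
  edges : Finset (E2 × E2)
  Kof : E2 × E2 → Tri
  Lof : E2 × E2 → Tri
  interior_disjoint : ∀ t₁ ∈ tris, ∀ t₂ ∈ tris, t₁ ≠ t₂ →
    interior t₁.carrier ∩ interior t₂.carrier = ∅
  union_eq : ⋃ t ∈ (tris : Set Tri), t.carrier = closure Ω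
  inter_structure : ∀ t₁ ∈ tris, ∀ t₂ ∈ tris, t₁ ≠ t₂ →
    t₁.carrier ∩ t₂.carrier = ∅
    ∨ (∃ a ∈ Set.range t₁.vtx ∩ Set.range t₂.vtx, t₁.carrier ∩ t₂.carrier = {a})
    ∨ (∃ σ, t₁.hasEdge σ ∧ t₂.hasEdge σ ∧ t₁.carrier ∩ t₂.carrier = eseg σ)
  angles_lt : ∀ t ∈ tris, ∀ i j l : Fin 3, i ≠ j → i ≠ l → j ≠ l →
    EuclideanGeometry.angle (t.vtx j) (t.vtx i) (t.vtx l) < Real.pi / 2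
  edges_ne : ∀ σ ∈ edges, σ.1 ≠ σ.2
  edges_cover : ∀ t ∈ tris, ∀ i j : Fin 3, i ≠ j →
    (t.vtx i, t.vtx j) ∈ edges ∨ (t.vtx j, t.vtx i) ∈ edges
  edges_sub : ∀ σ ∈ edges, ∃ t ∈ tris, t.hasEdge σ
  edges_orient : ∀ σ ∈ edges, Prod.swap σ ∉ edges
  edges_atMostTwo : ∀ σ ∈ edges, (tris.filter fun t => t.hasEdge σ).card ≤ 2
  Kof_mem : ∀ σ ∈ edges, Kof σ ∈ tris ∧ (Kof σ).hasEdge σ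
  Lof_mem : ∀ σ ∈ edges, (tris.filter fun t => t.hasEdge σ).card = 2 →
    Lof σ ∈ tris ∧ (Lof σ).hasEdge σ ∧ Lof σ ≠ Kof σ
  ext_frontier : ∀ σ ∈ edges, (tris.filter fun t => t.hasEdge σ).card = 1 →
    eseg σ ⊆ frontier Ω

namespace Mesh

variable {Ω : Set E2} (M : Mesh Ω)

/-- The interior edges `ℰ_h^int` (shared by exactly two triangles). -/
def intEdges : Finset (E2 × E2) :=
  M.edges.filter fun σ => (M.tris.filter fun t => t.hasEdge σ).card = 2

/-- The boundary edges `ℰ_h^ext`. -/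
def extEdges : Finset (E2 × E2) :=
  M.edges.filter fun σ => (M.tris.filter fun t => t.hasEdge σ).card = 1

/-- `d_σ`: distance between the circumcenters of the two triangles sharing `σ`
(interior edges), or from the circumcenter of `K_σ` to the midpoint of `σ`
(boundary edges). -/
def dOf (σ : E2 × E2) : ℝ :=
  if (M.tris.filter fun t => t.hasEdge σ).card = 2
  then dist (M.Kof σ).ccenter (M.Lof σ).ccenter
  else dist (M.Kof σ).ccenter (emid σ)

/-- `τ_σ = |σ| / d_σ`. -/
def tau (σ : E2 × E2) : ℝ := elen σ / M.dOf σ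

/-- The mesh size `h`: the largest diameter of a circumscribed circle. -/
def meshSize : ℝ := M.tris.sup' M.tris_nonempty fun t => 2 * t.simplex.circumradius

/-- Mesh regularity with constant `C_reg`: `d_σ ≥ C_reg |σ|` and `|σ| ≥ C_reg h`. -/
def Regular (Creg : ℝ) : Prop :=
  ∀ σ ∈ M.edges, Creg * elen σ ≤ M.dOf σ ∧ Creg * M.meshSize ≤ elen σ

/-- For `σ` an edge of `t`, the triangle on the other side of `σ`. -/
def other (t : Tri) (σ : E2 × E2) : Tri := if M.Kof σ = t then M.Lof σ else M.Kof σ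

/-- The `L²(Ω)` inner product of two piecewise constant (`P₀`) fields. -/
def l2P0 (v w : Tri → E2) : ℝ := ∑ t ∈ M.tris, t.area * ⟪v t, w t⟫

/-- The `L²(Ω)` norm of a `P₀` field. -/
def l2normP0 (v : Tri → E2) : ℝ := Real.sqrt (M.l2P0 v v)

/-- The discrete `H¹` norm `‖·‖_h` on `P₀`. -/
def normh (v : Tri → E2) : ℝ :=
  Real.sqrt (∑ σ ∈ M.intEdges, M.tau σ * ‖v (M.Lof σ) - v (M.Kof σ)‖ ^ 2
    + ∑ σ ∈ M.extEdges, M.tau σ * ‖v (M.Kof σ)‖ ^ 2)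

/-- A family of affine maps (one per triangle) is in `P₁^{nc}`: the two traces agree
at the midpoint of every interior edge. -/
def IsP1nc (q : Tri → (E2 →ᵃ[ℝ] ℝ)) : Prop :=
  ∀ σ ∈ M.intEdges, q (M.Kof σ) (emid σ) = q (M.Lof σ) (emid σ)

/-- Membership in `L²₀`: the piecewise affine function has zero mean on `Ω`. -/
def MeanZero (q : Tri → (E2 →ᵃ[ℝ] ℝ)) : Prop :=
  ∑ t ∈ M.tris, ∫ x in t.carrier, q t x = 0

/-- The `L²(Ω)` inner product of two piecewise affine functions. -/
def l2P1 (q r : Tri → (E2 →ᵃ[ℝ] ℝ)) : ℝ :=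
  ∑ t ∈ M.tris, ∫ x in t.carrier, q t x * r t x

/-- The `L²(Ω)` norm of a piecewise affine function. -/
def l2normP1 (q : Tri → (E2 →ᵃ[ℝ] ℝ)) : ℝ := Real.sqrt (M.l2P1 q q)

end Mesh

/-- The gradient (a constant vector) of an affine function on the plane. -/
def gradA (f : E2 →ᵃ[ℝ] ℝ) : E2 :=
  (InnerProductSpace.toDual ℝ E2).symm (LinearMap.toContinuousLinearMap f.linear)

/-- The discrete gradient `∇_h q` of a piecewise affine function: the piecewise
constant field equal on each triangle to the gradient of the affine piece. -/
def gradh (q : Tri → (E2 →ᵃ[ℝ] ℝ)) : Tri → E2 := fun t => gradA (q t)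

/-- The (constant) divergence of an affine vector field of the plane. -/
def divA (f : E2 →ᵃ[ℝ] E2) : ℝ := LinearMap.trace ℝ E2 f.linear

/-- The normal component `(u·n_{K,σ})_σ` of a piecewise affine field on the edge `σ`
of the triangle `t` (evaluated at the midpoint of `σ`). -/
def unrm (u : Tri → (E2 →ᵃ[ℝ] E2)) (t : Tri) (σ : E2 × E2) : ℝ :=
  ⟪u t (emid σ), t.nrm σ⟫

namespace Mesh

variable {Ω : Set E2} (M : Mesh Ω)

/-- The norm `‖q‖_{1,h} = (|q|² + |∇_h q|²)^{1/2}` on `P₁^{nc}`. -/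
def norm1h (q : Tri → (E2 →ᵃ[ℝ] ℝ)) : ℝ :=
  Real.sqrt ((M.l2normP1 q) ^ 2 + (M.l2normP0 (gradh q)) ^ 2)

/-- The prescribed value of `div_h v` at the midpoint of the edge `σ`. -/
def divhImage (v : Tri → E2) (σ : E2 × E2) : ℝ :=
  if (M.tris.filter fun t => t.hasEdge σ).card = 2 then
    (3 * elen σ / ((M.Kof σ).area + (M.Lof σ).area)) *
      ⟪v (M.Lof σ) - v (M.Kof σ), (M.Kof σ).nrm σ⟫
  else
    -((3 * elen σ / (M.Kof σ).area) * ⟪v (M.Kof σ), (M.Kof σ).nrm σ⟫)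

/-- `d = div_h v`: `d` is the element of `P₁^{nc}` taking the prescribed values at
the midpoints of the edges. -/
def IsDivh (v : Tri → E2) (d : Tri → (E2 →ᵃ[ℝ] ℝ)) : Prop :=
  M.IsP1nc d ∧
    ∀ t ∈ M.tris, ∀ σ ∈ M.edges, t.hasEdge σ → d t (emid σ) = M.divhImage v σ

/-- The discrete Laplacian `Δ̃_h` on `P₀`. -/
def laph (v : Tri → E2) : Tri → E2 := fun t =>
  (t.area)⁻¹ •
    ((∑ σ ∈ M.intEdges.filter fun σ => t.hasEdge σ, M.tau σ • (v (M.other t σ) - v t))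
      - ∑ σ ∈ M.extEdges.filter fun σ => t.hasEdge σ, M.tau σ • v t)

/-- The upwind convection operator `b̃_h(u_h, v_h) ∈ P₀`. -/
def btilde (u : Tri → (E2 →ᵃ[ℝ] E2)) (v : Tri → E2) : Tri → E2 := fun t =>
  (t.area)⁻¹ • ∑ σ ∈ M.intEdges.filter fun σ => t.hasEdge σ,
    elen σ • (max (unrm u t σ) 0 • v t + min (unrm u t σ) 0 • v (M.other t σ))

/-- The trilinear form `b_h(u_h, v_h, w_h)`. -/
def bh (u : Tri → (E2 →ᵃ[ℝ] E2)) (v w : Tri → E2) : ℝ :=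
  ∑ t ∈ M.tris, t.area * ⟪w t, M.btilde u v t⟫

/-- Membership in the lowest-order Raviart–Thomas space `RT₀`: the normal component is
constant on each edge of each triangle, matches across interior edges and vanishes on
boundary edges. -/
def IsRT0 (u : Tri → (E2 →ᵃ[ℝ] E2)) : Prop :=
  (∀ t ∈ M.tris, ∀ σ ∈ M.edges, t.hasEdge σ → ∀ x ∈ eseg σ,
      ⟪u t x, t.nrm σ⟫ = unrm u t σ)
  ∧ (∀ σ ∈ M.intEdges,
      ⟪u (M.Kof σ) (emid σ), (M.Kof σ).nrm σ⟫ =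
        ⟪u (M.Lof σ) (emid σ), (M.Kof σ).nrm σ⟫)
  ∧ (∀ σ ∈ M.extEdges, unrm u (M.Kof σ) σ = 0)

/-- Membership of a piecewise constant field in `P₀ ∩ RT₀`. -/
def IsRT0const (v : Tri → E2) : Prop :=
  (∀ σ ∈ M.intEdges, ⟪v (M.Lof σ) - v (M.Kof σ), (M.Kof σ).nrm σ⟫ = 0)
  ∧ ∀ σ ∈ M.extEdges, ⟪v (M.Kof σ), (M.Kof σ).nrm σ⟫ = 0

/-- The `L²(Ω)` norm of a piecewise affine vector field. -/
def l2normRT (u : Tri → (E2 →ᵃ[ℝ] E2)) : ℝ :=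
  Real.sqrt (∑ t ∈ M.tris, ∫ x in t.carrier, ‖u t x‖ ^ 2)

end Mesh

/-! ### Part 0 -/


/-- Signed area form: positive iff `q` is on the left of the directed line `a → b`. -/
def wD (a b q : ℝ × ℝ) : ℝ := (b.1 - a.1) * (q.2 - a.2) - (b.2 - a.2) * (q.1 - a.1)

/-- Signed crossing of the segment `a → b` with the horizontal ray to the right of `q`. -/
def wr (a b q : ℝ × ℝ) : ℤ :=
  if a.2 ≤ q.2 ∧ q.2 < b.2 ∧ 0 < wD a b q then 1
  else if b.2 ≤ q.2 ∧ q.2 < a.2 ∧ wD a b q < 0 then -1 else 0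

/-- Signed crossing of the segment `a → b` with the vertical ray above `q`. -/
def wr2 (a b q : ℝ × ℝ) : ℤ := - wr a.swap b.swap q.swap

/-- Quadrant indicator. -/
def wh (p q : ℝ × ℝ) : ℤ := if q.1 < p.1 ∧ q.2 < p.2 then 1 else 0

lemma wD_swap (a b q : ℝ × ℝ) : wD a.swap b.swap q.swap = - wD a b q := by
  simp only [wD, Prod.fst_swap, Prod.snd_swap]; ring

lemma wr2_eq (a b q : ℝ × ℝ) : wr2 a b q =
  if a.1 ≤ q.1 ∧ q.1 < b.1 ∧ wD a b q < 0 then -1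
  else if b.1 ≤ q.1 ∧ q.1 < a.1 ∧ 0 < wD a b q then 1 else 0 := by
  unfold wr2 wr
  rw [wD_swap]
  simp only [Prod.snd_swap, Left.neg_pos_iff, Left.neg_neg_iff]
  split_ifs <;> simp

lemma wr_anti (a b q : ℝ × ℝ) : wr b a q = - wr a b q := by
  have h : wD b a q = - wD a b q := by simp only [wD]; ring
  unfold wr; rw [h]
  simp only [Left.neg_pos_iff, Left.neg_neg_iff]
  split_ifs <;> first | rfl | (exfalso; grind)

/-- Quadrant identity off the line. -/
lemma wr_sub_of_ne (a b q : ℝ × ℝ) (hD : wD a b q ≠ 0) :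
    wr a b q - wr2 a b q = wh b q - wh a q := by
  obtain ⟨a1, a2⟩ := a
  obtain ⟨b1, b2⟩ := b
  obtain ⟨q1, q2⟩ := q
  rw [wr2_eq]
  unfold wr wh
  have hDe : wD (a1, a2) (b1, b2) (q1, q2) = (b1 - a1) * (q2 - a2) - (b2 - a2) * (q1 - a1) := rfl
  have hDe' : wD (a1, a2) (b1, b2) (q1, q2) = (b1 - q1) * (q2 - a2) - (b2 - q2) * (q1 - a1) := by
    rw [hDe]; ring
  generalize wD (a1, a2) (b1, b2) (q1, q2) = D at *
  simp only at *
  rcases lt_or_gt_of_ne hD with h | h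
  · have h' := h.le
    by_cases h1 : a1 ≤ q1 <;> by_cases h2 : b1 ≤ q1 <;> by_cases h3 : a2 ≤ q2 <;>
    by_cases h4 : b2 ≤ q2 <;>
    simp only [← not_le, h1, h2, h3, h4, h', not_true_eq_false, not_le.2 h, not_false_eq_true,
      and_true, true_and, and_false, false_and, and_self, if_true, if_false] <;>
    first
    | rfl
    | (exfalso; push Not at *; nlinarith)
  · have h' := h.le
    by_cases h1 : a1 ≤ q1 <;> by_cases h2 : b1 ≤ q1 <;> by_cases h3 : a2 ≤ q2 <;>
    by_cases h4 : b2 ≤ q2 <;>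
    simp only [← not_le, h1, h2, h3, h4, h', not_true_eq_false, not_le.2 h, not_false_eq_true,
      and_true, true_and, and_false, false_and, and_self, if_true, if_false] <;>
    first
    | rfl
    | (exfalso; push Not at *; nlinarith)

/-- Quadrant identity off the segment. -/
lemma wr_sub_of_notMem (a b q : ℝ × ℝ) (hq : q ∉ segment ℝ a b) :
    wr a b q - wr2 a b q = wh b q - wh a q := by
  by_cases hD : wD a b q = 0
  swap
  · exact wr_sub_of_ne a b q hD
  rw [wr2_eq]
  unfold wr wh
  simp only [hD, lt_irrefl, and_false, if_false]
  have key : ∀ a b : ℝ × ℝ, wD a b q = 0 → q ∉ segment ℝ a b →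
      (q.1 < a.1 ∧ q.2 < a.2) → (q.1 < b.1 ∧ q.2 < b.2) := by
    intro a b hD hq ⟨h1, h2⟩
    by_contra hcon
    apply hq
    unfold wD at hD
    rw [segment_eq_image']
    by_cases hb : q.1 < b.1
    · have hb2 : b.2 ≤ q.2 := by
        by_contra h; exact hcon ⟨hb, not_le.1 h⟩
      have hpos : 0 < a.2 - b.2 := by linarith
      refine ⟨(a.2 - q.2) / (a.2 - b.2), ⟨by apply div_nonneg <;> linarith, ?_⟩, ?_⟩
      · rw [div_le_one hpos]; linarith
      · ext
        · simp; field_simp; linarith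
        · simp; field_simp; ring
    · have hb2 : b.1 ≤ q.1 := not_lt.1 hb
      have hpos : 0 < a.1 - b.1 := by linarith
      refine ⟨(a.1 - q.1) / (a.1 - b.1), ⟨by apply div_nonneg <;> linarith, ?_⟩, ?_⟩
      · rw [div_le_one hpos]; linarith
      · ext
        · simp; field_simp; ring
        · simp; field_simp; linarith
  have hD' : wD b a q = 0 := by
    have : wD b a q = - wD a b q := by simp only [wD]; ring
    rw [this, hD, neg_zero]
  have hq' : q ∉ segment ℝ b a := by rwa [segment_symm]
  have h1 := key a b hD hq
  have h2 := key b a hD' hq'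
  have : (q.1 < a.1 ∧ q.2 < a.2) ↔ (q.1 < b.1 ∧ q.2 < b.2) := ⟨h1, h2⟩
  simp [this]

/-- Sum over a triangle: inside. -/
lemma wr_tri_pos (a b c q : ℝ × ℝ) (α β γ : ℝ) (hs : α + β + γ = 1)
    (hq : q = α • a + β • b + γ • c) (hdet : 0 < wD a b c) (hα : 0 < α) (hβ : 0 < β) (hγ : 0 < γ) :
    wr a b q + wr b c q + wr c a q = 1 := by
  have e1 : wD a b q = γ * wD a b c := by
    subst hq; obtain rfl : α = 1 - β - γ := by linarith
    simp [wD]; ring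
  have e2 : wD b c q = α * wD a b c := by
    subst hq; obtain rfl : α = 1 - β - γ := by linarith
    simp [wD]; ring
  have e3 : wD c a q = β * wD a b c := by
    subst hq; obtain rfl : α = 1 - β - γ := by linarith
    simp [wD]; ring
  have hy : α * (a.2 - q.2) + β * (b.2 - q.2) + γ * (c.2 - q.2) = 0 := by
    have : q.2 = α * a.2 + β * b.2 + γ * c.2 := by simp [hq]
    have h2 : q.2 = (α + β + γ) * q.2 := by rw [hs]; ring
    linarith
  have p1 : 0 < wD a b q := by rw [e1]; positivity
  have p2 : 0 < wD b c q := by rw [e2]; positivity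
  have p3 : 0 < wD c a q := by rw [e3]; positivity
  have hne : wD a b c ≠ 0 := hdet.ne'
  unfold wr
  simp only [p1, p2, p3, p1.not_gt, p2.not_gt, p3.not_gt, and_true, and_false, if_false]
  have hex1 : a.2 ≤ q.2 ∨ b.2 ≤ q.2 ∨ c.2 ≤ q.2 := by
    by_contra h; push Not at h
    nlinarith [mul_pos hα (sub_pos.2 h.1), mul_pos hβ (sub_pos.2 h.2.1), mul_pos hγ (sub_pos.2 h.2.2)]
  have hex2 : q.2 < a.2 ∨ q.2 < b.2 ∨ q.2 < c.2 := by
    by_contra h; push Not at h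
    -- all equal would make the triangle degenerate
    have h1 := mul_nonneg hα.le (sub_nonneg.2 h.1)
    have h2 := mul_nonneg hβ.le (sub_nonneg.2 h.2.1)
    have h3 := mul_nonneg hγ.le (sub_nonneg.2 h.2.2)
    have z1 : α * (q.2 - a.2) = 0 := by linarith
    have z2 : β * (q.2 - b.2) = 0 := by linarith
    have z3 : γ * (q.2 - c.2) = 0 := by linarith
    have y1 : q.2 - a.2 = 0 := (mul_eq_zero.1 z1).resolve_left hα.ne'
    have y2 : q.2 - b.2 = 0 := (mul_eq_zero.1 z2).resolve_left hβ.ne'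
    have y3 : q.2 - c.2 = 0 := (mul_eq_zero.1 z3).resolve_left hγ.ne'
    apply hne
    unfold wD
    rw [show c.2 - a.2 = 0 by linarith, show b.2 - a.2 = 0 by linarith]; ring
  by_cases h1 : a.2 ≤ q.2 <;> by_cases h2 : b.2 ≤ q.2 <;> by_cases h3 : c.2 ≤ q.2 <;>
  simp only [← not_le, h1, h2, h3, not_true_eq_false, not_false_eq_true,
      and_true, true_and, and_false, false_and, and_self, if_true, if_false] <;> first | rfl | skip
  · exact absurd hex2 (by simp [h1, h2, h3])
  · exact absurd hex1 (by simp [h1, h2, h3])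

/-- Sum over a triangle: outside. -/
lemma wr_tri_out (a b c q : ℝ × ℝ) (α β γ : ℝ) (hs : α + β + γ = 1)
    (hq : q = α • a + β • b + γ • c) (hdet : 0 < wD a b c) (hout : α < 0 ∨ β < 0 ∨ γ < 0) :
    wr a b q + wr b c q + wr c a q = 0 := by
  have e1 : wD a b q = γ * wD a b c := by
    subst hq; obtain rfl : α = 1 - β - γ := by linarith
    simp [wD]; ring
  have e2 : wD b c q = α * wD a b c := by
    subst hq; obtain rfl : α = 1 - β - γ := by linarith
    simp [wD]; ring
  have e3 : wD c a q = β * wD a b c := by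
    subst hq; obtain rfl : α = 1 - β - γ := by linarith
    simp [wD]; ring
  have hy : α * (a.2 - q.2) + β * (b.2 - q.2) + γ * (c.2 - q.2) = 0 := by
    have : q.2 = α * a.2 + β * b.2 + γ * c.2 := by simp [hq]
    have h2 : q.2 = (α + β + γ) * q.2 := by rw [hs]; ring
    linarith
  unfold wr
  rw [e1, e2, e3]
  simp only [mul_pos_iff_of_pos_right hdet, mul_neg_iff, hdet, hdet.not_gt, and_true, and_false, or_false, false_or]
  clear e1 e2 e3 hq hdet
  generalize q.2 = y at *
  generalize a.2 = A at *
  generalize b.2 = B at *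
  generalize c.2 = C at *
  have hsum : (α ≤ 0 ∧ β ≤ 0 ∧ γ ≤ 0) → False := fun h => by linarith [h.1, h.2.1, h.2.2]
  have hne : (0 ≤ α ∧ 0 ≤ β ∧ 0 ≤ γ) → False := fun h => by
    rcases hout with h' | h' | h' <;> linarith [h.1, h.2.1, h.2.2]
  by_cases h1 : A ≤ y <;> by_cases h2 : B ≤ y <;> by_cases h3 : C ≤ y <;>
  simp only [← not_le, h1, h2, h3, not_true_eq_false, not_false_eq_true,
      and_true, true_and, and_false, false_and, and_self, if_true, if_false] <;> first | rfl | skip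
  all_goals
    split_ifs <;> first | rfl | skip
  all_goals exfalso
  all_goals simp only [not_le, not_lt] at *
  all_goals rcases lt_or_ge α 0 with hα | hα
  all_goals rcases lt_or_ge β 0 with hβ | hβ
  all_goals rcases lt_or_ge γ 0 with hγ | hγ
  all_goals first
    | exact hsum ⟨by linarith, by linarith, by linarith⟩
    | exact hne ⟨by linarith, by linarith, by linarith⟩
    | linarith
    | nlinarith

/-! ### Part 1 -/


/-- Signed indicator of the interval between `a` and `b`. -/
def wchi (a b s : ℝ) : ℤ := (if s < b then 1 else 0) - (if s < a then 1 else 0)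

/-- Unsigned indicator of the interval between `a` and `b`. -/
def wc (a b s : ℝ) : ℕ := (wchi a b s).natAbs

lemma wr_natAbs_le (a b q : ℝ × ℝ) : (wr a b q).natAbs ≤ wc a.2 b.2 q.2 := by
  unfold wr wc wchi
  split_ifs <;> first | (simp; done) | (exfalso; grind)

lemma wr2_natAbs_le (a b q : ℝ × ℝ) : (wr2 a b q).natAbs ≤ wc a.1 b.1 q.1 := by
  unfold wr2
  rw [Int.natAbs_neg]
  exact wr_natAbs_le _ _ _

lemma wc_symm (a b s : ℝ) : wc a b s = wc b a s := by
  unfold wc wchi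
  rw [← Int.natAbs_neg]; congr 1; ring

lemma measurable_wchi (a b : ℝ) : Measurable (wchi a b) := by
  unfold wchi
  apply Measurable.sub
  · exact Measurable.ite measurableSet_Iio measurable_const measurable_const
  · exact Measurable.ite measurableSet_Iio measurable_const measurable_const

lemma measurable_wc (a b : ℝ) : Measurable (wc a b) := 
  (measurable_of_countable Int.natAbs).comp (measurable_wchi a b)

lemma continuous_wD (a b : ℝ × ℝ) : Continuous (wD a b) := by
  unfold wD; fun_prop

lemma measurable_wr (a b : ℝ × ℝ) : Measurable (wr a b) := by
  unfold wr
  have hD := (continuous_wD a b).measurable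
  refine Measurable.ite ?_ measurable_const (Measurable.ite ?_ measurable_const measurable_const)
  · refine (measurableSet_le measurable_const measurable_snd).inter
      ((measurableSet_lt measurable_snd measurable_const).inter (measurableSet_lt measurable_const hD))
  · refine (measurableSet_le measurable_const measurable_snd).inter
      ((measurableSet_lt measurable_snd measurable_const).inter (measurableSet_lt hD measurable_const))

lemma lintegral_wc (a b : ℝ) : ∫⁻ s, (wc a b s : ENNReal) = ENNReal.ofReal |b - a| := by
  wlog hab : a ≤ b generalizing a b
  · rw [abs_sub_comm, ← this b a (le_of_not_ge hab)]
    simp_rw [wc_symm a b]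
  have : (fun s => (wc a b s : ENNReal)) = Set.indicator (Set.Ico a b) 1 := by
    ext s
    unfold wc wchi
    by_cases h1 : s < a
    · have h2 : s < b := h1.trans_le hab
      simp [h1, h2, Set.indicator]
    · by_cases h2 : s < b <;> simp [h1, h2, Set.indicator, not_lt.1 h1]
  rw [this, lintegral_indicator_one measurableSet_Ico, Real.volume_Ico, abs_of_nonneg (by linarith)]

lemma integrable_wchi (a b : ℝ) : Integrable (fun s => (wchi a b s : ℝ)) := by
  refine ⟨((measurable_of_countable (fun n : ℤ => (n : ℝ))).comp (measurable_wchi a b)).aestronglyMeasurable, ?_⟩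
  have : ∀ s, ‖(wchi a b s : ℝ)‖ₑ = (wc a b s : ENNReal) := by
    intro s
    unfold wc
    rw [← ofReal_norm, Real.norm_eq_abs, ← Int.cast_abs, Int.abs_eq_natAbs, Int.cast_natCast]
    exact ENNReal.ofReal_natCast _
  rw [HasFiniteIntegral]
  simp_rw [this]
  rw [lintegral_wc]; exact ENNReal.ofReal_lt_top

lemma integral_wchi (a b : ℝ) : ∫ s, (wchi a b s : ℝ) = b - a := by
  wlog hab : a ≤ b generalizing a b
  · have := this b a (le_of_not_ge hab)
    have h2 : ∀ s, (wchi a b s : ℝ) = - (wchi b a s : ℝ) := by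
      intro s; unfold wchi; push_cast; ring
    simp_rw [h2]; rw [integral_neg, this]; ring
  have : (fun s => (wchi a b s : ℝ)) = Set.indicator (Set.Ico a b) 1 := by
    ext s
    unfold wchi
    by_cases h1 : s < a
    · have h2 : s < b := h1.trans_le hab
      simp [h1, h2, Set.indicator]
    · by_cases h2 : s < b <;> simp [h1, h2, Set.indicator, not_lt.1 h1]
  rw [this, integral_indicator_one measurableSet_Ico]
  simp [hab]

/-- The quadrant identity holds almost everywhere. -/
lemma wr_sub_ae (a b : ℝ × ℝ) :
    ∀ᵐ q : ℝ × ℝ, wr a b q - wr2 a b q = wh b q - wh a q := by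
  by_cases hab : a = b
  · subst hab
    refine Filter.Eventually.of_forall fun q => ?_
    have h1 : wr a a q = 0 := by have := wr_anti a a q; omega
    have h2 : wr2 a a q = 0 := by unfold wr2; have := wr_anti a.swap a.swap q.swap; omega
    rw [h1, h2]; ring
  have hnull : volume {q : ℝ × ℝ | wD a b q = 0} = 0 := by
    rw [Measure.volume_eq_prod, Measure.measure_prod_null]
    swap
    · exact measurableSet_eq_fun (continuous_wD a b).measurable measurable_const
    by_cases h1 : b.1 = a.1
    · have h2 : b.2 - a.2 ≠ 0 := by
        intro h; exact hab (Prod.ext h1.symm (by linarith))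
      have : ∀ᵐ x : ℝ, x ≠ a.1 := by
        simp [ae_iff]
      filter_upwards [this] with x hx
      have : Prod.mk x ⁻¹' {q : ℝ × ℝ | wD a b q = 0} = ∅ := by
        ext y
        simp only [wD, Set.mem_preimage, Set.mem_ofPred_eq, h1, sub_self, zero_mul, zero_sub,
          neg_eq_zero, mul_eq_zero, Set.mem_empty_iff_false, iff_false, not_or]
        exact ⟨h2, sub_ne_zero.2 hx⟩
      rw [this]; simp
    · refine Filter.Eventually.of_forall fun x => ?_
      have : (Prod.mk x ⁻¹' {q : ℝ × ℝ | wD a b q = 0}).Subsingleton := by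
        intro y hy y' hy'
        simp only [wD, Set.mem_preimage, Set.mem_ofPred_eq] at hy hy'
        have : (b.1 - a.1) * (y - y') = 0 := by linarith
        rcases mul_eq_zero.1 this with h | h
        · exact absurd (by linarith) h1
        · linarith
      exact this.measure_zero _
  have : ∀ᵐ q : ℝ × ℝ, wD a b q ≠ 0 := by
    rw [ae_iff]; simpa using hnull
  filter_upwards [this] with q hq
  exact wr_sub_of_ne a b q hq

/-- The integral of the crossing function over a large box. -/
lemma integral_wr (a b : ℝ × ℝ) (R : ℝ) (ha1 : |a.1| < R) (ha2 : |a.2| < R)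
    (hb1 : |b.1| < R) (hb2 : |b.2| < R) :
    ∫ q in (Set.Ioo (-R) R ×ˢ Set.Ioo (-R) R : Set (ℝ × ℝ)), (wr a b q : ℝ) =
      (b.2 - a.2) * ((a.1 + b.1) / 2 + R) := by
  wlog hab : a.2 ≤ b.2 generalizing a b
  · have := this b a hb1 hb2 ha1 ha2 (le_of_not_ge hab)
    simp_rw [wr_anti b a]; push_cast; rw [integral_neg, this]; ring
  rcases hab.eq_or_lt with hab | hab
  · have : ∀ q, wr a b q = 0 := by
      intro q; unfold wr; rw [hab]
      split_ifs <;> first | rfl | (exfalso; grind)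
    simp_rw [this]; simp [hab]
  have hpos : 0 < b.2 - a.2 := by linarith
  set f : ℝ → ℝ := fun _ => -R
  set g : ℝ → ℝ := fun y => a.1 + (b.1 - a.1) / (b.2 - a.2) * (y - a.2) with hg
  set B : Set (ℝ × ℝ) := (Set.Ioo (-R) R ×ˢ Set.Ioo (-R) R : Set (ℝ × ℝ))
  set S : Set (ℝ × ℝ) := Prod.swap ⁻¹' regionBetween f g (Set.Ico a.2 b.2) with hS
  rw [abs_lt] at *
  have hbd : ∀ y ∈ Set.Ico a.2 b.2, -R < g y ∧ g y < R := by
    intro y hy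
    have : g y = (1 - (y - a.2) / (b.2 - a.2)) * a.1 + (y - a.2) / (b.2 - a.2) * b.1 := by
      rw [hg]; field_simp; ring
    have h0 : 0 ≤ (y - a.2) / (b.2 - a.2) := div_nonneg (by linarith [hy.1]) hpos.le
    have h1 : (y - a.2) / (b.2 - a.2) ≤ 1 := by rw [div_le_one hpos]; linarith [hy.2]
    rw [this]
    generalize (y - a.2) / (b.2 - a.2) = t at *
    obtain ⟨ha, ha'⟩ := ha1
    obtain ⟨hb, hb'⟩ := hb1
    rcases h0.eq_or_lt with h0 | h0
    · rw [← h0]; constructor <;> linarith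
    · constructor <;> nlinarith
  have hmS : MeasurableSet S := by
    apply measurable_swap
    exact measurableSet_regionBetween measurable_const (by fun_prop) measurableSet_Ico
  have e : ∀ q ∈ B, (wr a b q : ℝ) = S.indicator 1 q := by
    intro q hq
    have hDg : 0 < wD a b q ↔ q.1 < g q.2 := by
      have : wD a b q = (b.2 - a.2) * (g q.2 - q.1) := by
        simp only [wD, hg]; field_simp; ring
      rw [this, mul_pos_iff_of_pos_left hpos, sub_pos]
    have hSq : q ∈ S ↔ (a.2 ≤ q.2 ∧ q.2 < b.2) ∧ (-R < q.1 ∧ q.1 < g q.2) := by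
      simp [hS, regionBetween, f]
    have hq1 : -R < q.1 := hq.1.1
    unfold wr
    by_cases hqS : q ∈ S
    · rw [Set.indicator_of_mem hqS]
      rw [hSq] at hqS
      rw [if_pos ⟨hqS.1.1, hqS.1.2, hDg.2 hqS.2.2⟩]; simp
    · rw [Set.indicator_of_notMem hqS]
      rw [hSq] at hqS
      rw [if_neg, if_neg]
      · simp
      · intro h; linarith [h.1, h.2.1]
      · intro h; exact hqS ⟨⟨h.1, h.2.1⟩, hq1, hDg.1 h.2.2⟩
  have hmB : MeasurableSet B := measurableSet_Ioo.prod measurableSet_Ioo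
  rw [setIntegral_congr_fun hmB e, setIntegral_indicator hmS]
  have hSB : S ⊆ B := by
    intro q hq
    have hSq : (a.2 ≤ q.2 ∧ q.2 < b.2) ∧ (-R < q.1 ∧ q.1 < g q.2) := by
      simpa [hS, regionBetween, f] using hq
    have := hbd q.2 ⟨hSq.1.1, hSq.1.2⟩
    exact ⟨⟨hSq.2.1, by linarith [hSq.2.2]⟩, ⟨by linarith [hSq.1.1], by linarith [hSq.1.2]⟩⟩
  rw [Set.inter_eq_right.2 hSB]
  simp only [Pi.one_apply, integral_const, smul_eq_mul, mul_one, measureReal_def,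
    Measure.restrict_apply MeasurableSet.univ, Set.univ_inter]
  have hv : volume S = volume (regionBetween f g (Set.Ico a.2 b.2)) := by
    rw [hS]
    exact (Measure.measurePreserving_swap (μ := (volume : Measure ℝ)) (ν := (volume : Measure ℝ))).measure_preimage
      (measurableSet_regionBetween measurable_const (by fun_prop) measurableSet_Ico).nullMeasurableSet
  have hfi : ∀ f : ℝ → ℝ, Continuous f → IntegrableOn f (Set.Ico a.2 b.2) := fun f hf =>
    (hf.integrableOn_Icc (a := a.2) (b := b.2)).mono_set Set.Ico_subset_Icc_self
  have hgc : Continuous g := by fun_prop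
  rw [hv, Measure.volume_eq_prod, volume_regionBetween_eq_integral (hfi f continuous_const)
    (hfi g hgc) measurableSet_Ico (fun y hy => (hbd y hy).1.le)]
  rw [integral_Ico_eq_integral_Ioc, ← intervalIntegral.integral_of_le hab.le]
  have hint : ∫ y in a.2..b.2, (g - f) y = (b.2 - a.2) * ((a.1 + b.1) / 2 + R) := by
    have hk := div_mul_cancel₀ (b.1 - a.1) hpos.ne'
    simp only [hg, f, Pi.sub_apply]
    generalize (b.1 - a.1) / (b.2 - a.2) = κ at hk
    rw [show (fun y => a.1 + κ * (y - a.2) - -R) = fun y => 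
      (a.1 + R - κ * a.2) + κ * y by ext y; ring]
    rw [intervalIntegral.integral_add (by simp) (by apply Continuous.intervalIntegrable; fun_prop)]
    rw [intervalIntegral.integral_const_mul]
    simp only [intervalIntegral.integral_const, integral_id, smul_eq_mul]
    have : b.1 = κ * (b.2 - a.2) + a.1 := by linarith
    rw [this]; ring
  rw [hint, ENNReal.toReal_ofReal]
  apply mul_nonneg hpos.le; linarith

/-! ### Part 2 -/


/-- A convenient form of the Cauchy–Schwarz inequality. -/
lemma lintegral_cs {α : Type*} [MeasurableSpace α] {μ : Measure α} (n p r : α → ENNReal)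
    (hp : AEMeasurable p μ) (hr : AEMeasurable r μ) (h : ∀ᵐ x ∂μ, n x ^ 2 ≤ p x * r x) :
    (∫⁻ x, n x ∂μ) ^ 2 ≤ (∫⁻ x, p x ∂μ) * ∫⁻ x, r x ∂μ := by
  have hsq : ∀ x : ENNReal, (x ^ (1 / 2 : ℝ)) ^ (2 : ℝ) = x := by
    intro x; rw [← ENNReal.rpow_mul]; norm_num
  have hsq2 : ∀ x : ENNReal, (x ^ 2) ^ (1 / 2 : ℝ) = x := by
    intro x; rw [← ENNReal.rpow_natCast, ← ENNReal.rpow_mul]; norm_num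
  have hsq3 : ∀ x : ENNReal, (x ^ (1 / 2 : ℝ)) ^ 2 = x := by
    intro x; rw [← ENNReal.rpow_natCast]; exact_mod_cast hsq x
  have h1 : ∫⁻ x, n x ∂μ ≤ ∫⁻ x, (((fun x => p x ^ (1 / 2 : ℝ)) * fun x => r x ^ (1 / 2 : ℝ)) : α → ENNReal) x ∂μ := by
    apply lintegral_mono_ae
    filter_upwards [h] with x hx
    rw [Pi.mul_apply, ← ENNReal.mul_rpow_of_nonneg _ _ (by norm_num), ← hsq2 (n x)]
    exact ENNReal.rpow_le_rpow hx (by norm_num)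
  have h2 := ENNReal.lintegral_mul_le_Lp_mul_Lq μ (Real.HolderConjugate.two_two)
    (hp.pow_const (1 / 2 : ℝ)) (hr.pow_const (1 / 2 : ℝ))
  simp only [hsq] at h2
  calc _ ≤ ((∫⁻ x, p x ∂μ) ^ (1 / 2 : ℝ) * (∫⁻ x, r x ∂μ) ^ (1 / 2 : ℝ)) ^ 2 := by
        gcongr; exact h1.trans h2
    _ = _ := by rw [mul_pow, hsq3, hsq3]

section abstract_ineq

variable {ι V T : Type*}

lemma natAbs_sum_wr_le (E : Finset ι) (c : ι → ℤ) (k l : ι → T) (z : T → ℝ × ℝ) (q : ℝ × ℝ) :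
    (∑ σ ∈ E, c σ * wr (z (k σ)) (z (l σ)) q).natAbs ≤
      ∑ σ ∈ E, (c σ).natAbs * wc (z (k σ)).2 (z (l σ)).2 q.2 := by
  refine (Int.natAbs_sum_le _ _).trans ?_
  refine Finset.sum_le_sum fun σ _ => ?_
  rw [Int.natAbs_mul]
  exact Nat.mul_le_mul_left _ (wr_natAbs_le _ _ _)

lemma natAbs_sum_wr_le' (E : Finset ι) (a b : ι → V) (k l : ι → T)
    (H : ∀ (φ : V → ℝ) (h : T → ℝ),
      ∑ σ ∈ E, (φ (b σ) - φ (a σ)) * (h (l σ) - h (k σ)) = 0)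
    (φ : V → ℤ) (z : T → ℝ × ℝ) (q : ℝ × ℝ)
    (hq : ∀ σ ∈ E, wr (z (k σ)) (z (l σ)) q - wr2 (z (k σ)) (z (l σ)) q =
      wh (z (l σ)) q - wh (z (k σ)) q) :
    (∑ σ ∈ E, (φ (b σ) - φ (a σ)) * wr (z (k σ)) (z (l σ)) q).natAbs ≤
      ∑ σ ∈ E, (φ (b σ) - φ (a σ)).natAbs * wc (z (k σ)).1 (z (l σ)).1 q.1 := by
  have HZ : ∑ σ ∈ E, (φ (b σ) - φ (a σ)) * (wh (z (l σ)) q - wh (z (k σ)) q) = 0 := by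
    have := H (fun v => φ v) (fun t => wh (z t) q)
    exact_mod_cast this
  have e : ∑ σ ∈ E, (φ (b σ) - φ (a σ)) * wr (z (k σ)) (z (l σ)) q =
      ∑ σ ∈ E, (φ (b σ) - φ (a σ)) * wr2 (z (k σ)) (z (l σ)) q := by
    rw [← sub_eq_zero, ← Finset.sum_sub_distrib, ← HZ]
    refine Finset.sum_congr rfl fun σ hσ => ?_
    rw [← hq σ hσ]; ring
  rw [e]
  refine (Int.natAbs_sum_le _ _).trans ?_
  refine Finset.sum_le_sum fun σ _ => ?_
  rw [Int.natAbs_mul]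
  exact Nat.mul_le_mul_left _ (wr2_natAbs_le _ _ _)

lemma lintegral_sum_wc (E : Finset ι) (n : ι → ℕ) (x y : ι → ℝ) :
    ∫⁻ s, ((∑ σ ∈ E, n σ * wc (x σ) (y σ) s : ℕ) : ENNReal) =
      ENNReal.ofReal (∑ σ ∈ E, (n σ : ℝ) * |y σ - x σ|) := by
  push_cast
  rw [lintegral_finsetSum]
  · rw [ENNReal.ofReal_sum_of_nonneg (fun _ _ => by positivity)]
    refine Finset.sum_congr rfl fun σ _ => ?_
    rw [lintegral_const_mul, lintegral_wc, ENNReal.ofReal_mul (by positivity), ENNReal.ofReal_natCast]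
    exact (measurable_of_countable (fun n : ℕ => (n : ENNReal))).comp (measurable_wc _ _)
  · intro σ _
    exact ((measurable_of_countable (fun n : ℕ => (n : ENNReal))).comp (measurable_wc _ _)).const_mul _

lemma measurable_sum_wc (E : Finset ι) (n : ι → ℕ) (x y : ι → ℝ) :
    Measurable fun s => ((∑ σ ∈ E, n σ * wc (x σ) (y σ) s : ℕ) : ENNReal) := by
  apply (measurable_of_countable (fun n : ℕ => (n : ENNReal))).comp
  exact Finset.measurable_fun_sum _ fun σ _ => (measurable_wc _ _).const_mul _

lemma lintegral_prod_wc {ι' : Type*} (E : Finset ι) (n : ι → ℕ) (x y : ι → ℝ)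
    (E' : Finset ι') (n' : ι' → ℕ) (x' y' : ι' → ℝ) :
    ∫⁻ q : ℝ × ℝ, ((∑ σ ∈ E, n σ * wc (x σ) (y σ) q.2 : ℕ) : ENNReal) *
      ((∑ σ ∈ E', n' σ * wc (x' σ) (y' σ) q.1 : ℕ) : ENNReal) =
      ENNReal.ofReal ((∑ σ ∈ E, (n σ : ℝ) * |y σ - x σ|) * (∑ σ ∈ E', (n' σ : ℝ) * |y' σ - x' σ|)) := by
  have h := lintegral_prod_mul (μ := (volume : Measure ℝ)) (ν := (volume : Measure ℝ))
    (measurable_sum_wc E' n' x' y').aemeasurable (measurable_sum_wc E n x y).aemeasurable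
  rw [lintegral_sum_wc, lintegral_sum_wc] at h
  rw [ENNReal.ofReal_mul (Finset.sum_nonneg fun _ _ => by positivity), mul_comm, ← h]
  rw [Measure.volume_eq_prod]
  refine lintegral_congr fun q => ?_
  rw [mul_comm]

/-- Abstract isoperimetric-type inequality. -/
lemma abstract_bound (E : Finset ι) (a b : ι → V) (k l : ι → T) (Vs : Finset V)
    (ha : ∀ σ ∈ E, a σ ∈ Vs) (hb : ∀ σ ∈ E, b σ ∈ Vs)
    (H : ∀ (φ : V → ℝ) (h : T → ℝ),
      ∑ σ ∈ E, (φ (b σ) - φ (a σ)) * (h (l σ) - h (k σ)) = 0)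
    (ψ : V → ℝ) (x y : T → ℝ) :
    (∑ σ ∈ E, (ψ (b σ) - ψ (a σ)) * (x (k σ) * y (l σ) - x (l σ) * y (k σ))) ^ 2 ≤
      4 * ((∑ σ ∈ E, |ψ (b σ) - ψ (a σ)| * |y (l σ) - y (k σ)|) *
        ((∑ σ ∈ E, |ψ (b σ) - ψ (a σ)| * |x (l σ) - x (k σ)|) *
        ∑ v ∈ Vs, (∑ σ ∈ E with a σ = v ∨ b σ = v, |y (l σ) - y (k σ)|) *
          (∑ σ ∈ E with a σ = v ∨ b σ = v, |x (l σ) - x (k σ)|))) := by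
  set z : T → ℝ × ℝ := fun t => (x t, y t) with hz
  set A1 := ∑ v ∈ Vs, (∑ σ ∈ E with a σ = v ∨ b σ = v, |y (l σ) - y (k σ)|) *
          (∑ σ ∈ E with a σ = v ∨ b σ = v, |x (l σ) - x (k σ)|) with hA1
  set N : ℝ → ℝ × ℝ → ℤ := fun s q =>
    ∑ σ ∈ E, wchi (ψ (a σ)) (ψ (b σ)) s * wr (z (k σ)) (z (l σ)) q with hN
  set f : ℝ → ℝ → ℕ := fun s r => ∑ σ ∈ E, wc (ψ (a σ)) (ψ (b σ)) s * wc (y (k σ)) (y (l σ)) r with hf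
  set g : ℝ → ℝ → ℕ := fun s r => ∑ σ ∈ E, wc (ψ (a σ)) (ψ (b σ)) s * wc (x (k σ)) (x (l σ)) r with hg
  set Rv : V → ℝ × ℝ → ℤ := fun v q =>
    ∑ σ ∈ E, ((if b σ = v then 1 else 0) - (if a σ = v then 1 else 0)) *
      wr (z (k σ)) (z (l σ)) q with hRv
  set K : ℝ × ℝ → ℕ := fun q => ∑ v ∈ Vs, (Rv v q).natAbs with hK
  have hgood : ∀ᵐ q : ℝ × ℝ, ∀ σ ∈ E, wr (z (k σ)) (z (l σ)) q - wr2 (z (k σ)) (z (l σ)) q =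
      wh (z (l σ)) q - wh (z (k σ)) q := by
    rw [Filter.eventually_all_finset]
    exact fun σ _ => wr_sub_ae _ _
  have hNf : ∀ s q, (N s q).natAbs ≤ f s q.2 := fun s q => natAbs_sum_wr_le E _ k l z q
  have hNg : ∀ᵐ q : ℝ × ℝ, ∀ s, (N s q).natAbs ≤ g s q.1 := by
    filter_upwards [hgood] with q hq s
    exact natAbs_sum_wr_le' E a b k l H (fun v => if s < ψ v then 1 else 0) z q hq
  have hNK : ∀ s q, (N s q).natAbs ≤ K q := by
    intro s q
    have e : N s q = ∑ v ∈ Vs, (if s < ψ v then 1 else 0) * Rv v q := by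
      simp only [hN, hRv, Finset.mul_sum]
      rw [Finset.sum_comm]
      refine Finset.sum_congr rfl fun σ hσ => ?_
      have : ∀ v, (if s < ψ v then (1:ℤ) else 0) * (((if b σ = v then 1 else 0) -
          (if a σ = v then 1 else 0)) * wr (z (k σ)) (z (l σ)) q) =
          (if b σ = v then (if s < ψ v then (1:ℤ) else 0) * wr (z (k σ)) (z (l σ)) q else 0) -
          (if a σ = v then (if s < ψ v then (1:ℤ) else 0) * wr (z (k σ)) (z (l σ)) q else 0) := by
        intro v; split_ifs <;> ring
      simp_rw [this]
      rw [Finset.sum_sub_distrib, Finset.sum_ite_eq, Finset.sum_ite_eq, if_pos (ha σ hσ), if_pos (hb σ hσ)]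
      unfold wchi; ring
    rw [e]
    refine (Int.natAbs_sum_le _ _).trans (Finset.sum_le_sum fun v _ => ?_)
    split_ifs <;> simp
  have hmK : Measurable fun q => (K q : ENNReal) := by
    apply (measurable_of_countable (fun n : ℕ => (n : ENNReal))).comp
    refine Finset.measurable_fun_sum _ fun v _ => ?_
    refine (measurable_of_countable Int.natAbs).comp ?_
    exact Finset.measurable_fun_sum _ fun σ _ => (measurable_wr _ _).const_mul _
  have hKint : ∫⁻ q, (K q : ENNReal) ≤ ENNReal.ofReal A1 := by
    have hv : ∀ v ∈ Vs, ∫⁻ q, ((Rv v q).natAbs : ENNReal) ≤ 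
      ENNReal.ofReal ((∑ σ ∈ E with a σ = v ∨ b σ = v, |y (l σ) - y (k σ)|) *
          (∑ σ ∈ E with a σ = v ∨ b σ = v, |x (l σ) - x (k σ)|)) := by
      intro v _
      set m : ι → ℕ := fun σ => if a σ = v ∨ b σ = v then 1 else 0 with hm
      have hmle : ∀ σ, ((if b σ = v then (1:ℤ) else 0) - (if a σ = v then 1 else 0)).natAbs ≤ m σ := by
        intro σ; simp only [hm]
        by_cases h1 : a σ = v <;> by_cases h2 : b σ = v <;> simp [h1, h2]
      have hfilt : ∀ u : ι → ℝ, ∑ σ ∈ E with a σ = v ∨ b σ = v, u σ = ∑ σ ∈ E, (m σ : ℝ) * u σ := by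
        intro u
        rw [Finset.sum_filter]
        refine Finset.sum_congr rfl fun σ _ => ?_
        simp only [hm]; split_ifs <;> simp
      rw [hfilt, hfilt, ← lintegral_prod_wc]
      apply lintegral_mono_ae
      filter_upwards [hgood] with q hq
      have h1 : (Rv v q).natAbs ≤ ∑ σ ∈ E, m σ * wc (y (k σ)) (y (l σ)) q.2 :=
        (natAbs_sum_wr_le E _ k l z q).trans
          (Finset.sum_le_sum fun σ _ => Nat.mul_le_mul_right _ (hmle σ))
      have h2 : (Rv v q).natAbs ≤ ∑ σ ∈ E, m σ * wc (x (k σ)) (x (l σ)) q.1 :=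
        (natAbs_sum_wr_le' E a b k l H (fun w => if w = v then 1 else 0) z q hq).trans
          (Finset.sum_le_sum fun σ _ => Nat.mul_le_mul_right _ (hmle σ))
      have h3 : (Rv v q).natAbs ≤ (∑ σ ∈ E, m σ * wc (y (k σ)) (y (l σ)) q.2) *
          (∑ σ ∈ E, m σ * wc (x (k σ)) (x (l σ)) q.1) :=
        (Nat.le_mul_self _).trans (Nat.mul_le_mul h1 h2)
      exact_mod_cast h3
    calc ∫⁻ q, (K q : ENNReal) = ∑ v ∈ Vs, ∫⁻ q, ((Rv v q).natAbs : ENNReal) := by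
          simp only [hK]; push_cast
          rw [lintegral_finsetSum]
          intro v _
          apply (measurable_of_countable (fun n : ℕ => (n : ENNReal))).comp
          refine (measurable_of_countable Int.natAbs).comp ?_
          exact Finset.measurable_fun_sum _ fun σ _ => (measurable_wr _ _).const_mul _
      _ ≤ _ := Finset.sum_le_sum hv
      _ = ENNReal.ofReal A1 := by
          rw [ENNReal.ofReal_sum_of_nonneg]
          intro v _
          exact mul_nonneg (Finset.sum_nonneg fun _ _ => abs_nonneg _) (Finset.sum_nonneg fun _ _ => abs_nonneg _)
  -- first Cauchy–Schwarz
  have hCS1 : ∀ s, (∫⁻ q, ((N s q).natAbs : ENNReal)) ^ 2 ≤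
      ENNReal.ofReal (∑ σ ∈ E, (wc (ψ (a σ)) (ψ (b σ)) s : ℝ) * |y (l σ) - y (k σ)|) *
      (ENNReal.ofReal (∑ σ ∈ E, (wc (ψ (a σ)) (ψ (b σ)) s : ℝ) * |x (l σ) - x (k σ)|) *
      ENNReal.ofReal A1) := by
    intro s
    rw [← mul_assoc, ← ENNReal.ofReal_mul (Finset.sum_nonneg fun _ _ => by positivity),
      ← lintegral_prod_wc]
    refine (lintegral_cs _ (fun q => (f s q.2 : ENNReal) * (g s q.1 : ENNReal))
      (fun q => (K q : ENNReal)) ?_ hmK.aemeasurable ?_).trans ?_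
    · exact (((measurable_sum_wc E _ _ _).comp measurable_snd).mul
        ((measurable_sum_wc E _ _ _).comp measurable_fst)).aemeasurable
    · filter_upwards [hNg] with q hq
      have h1 := hNf s q
      have h2 := hq s
      have h3 := hNK s q
      generalize (N s q).natAbs = n at *
      have h4 : n ^ 2 ≤ f s q.2 * g s q.1 * K q := by
        rcases Nat.eq_zero_or_pos n with h | h
        · subst h; simp
        · calc n ^ 2 ≤ n ^ 3 := Nat.pow_le_pow_right h (by norm_num)
            _ = n * n * n := by ring
            _ ≤ _ := Nat.mul_le_mul (Nat.mul_le_mul h1 h2) h3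
      exact_mod_cast h4
    · gcongr
  have hsum : ∀ u : T → ℝ, ∀ s, ENNReal.ofReal (∑ σ ∈ E, (wc (ψ (a σ)) (ψ (b σ)) s : ℝ) * |u (l σ) - u (k σ)|)
      = ∑ σ ∈ E, ENNReal.ofReal |u (l σ) - u (k σ)| * (wc (ψ (a σ)) (ψ (b σ)) s : ENNReal) := by
    intro u s
    rw [ENNReal.ofReal_sum_of_nonneg (fun _ _ => by positivity)]
    refine Finset.sum_congr rfl fun σ _ => ?_
    rw [ENNReal.ofReal_mul (by positivity), ENNReal.ofReal_natCast, mul_comm]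
  have hmwc : ∀ u v : ℝ, Measurable fun s => (wc u v s : ENNReal) := fun u v =>
    (measurable_of_countable (fun n : ℕ => (n : ENNReal))).comp (measurable_wc _ _)
  have hsumM : ∀ u : T → ℝ, Measurable fun s => 
      ∑ σ ∈ E, ENNReal.ofReal |u (l σ) - u (k σ)| * (wc (ψ (a σ)) (ψ (b σ)) s : ENNReal) := by
    intro u
    exact Finset.measurable_fun_sum _ fun σ _ => (hmwc _ _).const_mul _
  have hsumI : ∀ u : T → ℝ, ∫⁻ s, 
      ∑ σ ∈ E, ENNReal.ofReal |u (l σ) - u (k σ)| * (wc (ψ (a σ)) (ψ (b σ)) s : ENNReal) = 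
      ENNReal.ofReal (∑ σ ∈ E, |ψ (b σ) - ψ (a σ)| * |u (l σ) - u (k σ)|) := by
    intro u
    rw [lintegral_finsetSum _ fun σ _ => (hmwc _ _).const_mul _,
      ENNReal.ofReal_sum_of_nonneg (fun _ _ => by positivity)]
    refine Finset.sum_congr rfl fun σ _ => ?_
    rw [lintegral_const_mul _ (hmwc _ _), lintegral_wc, ENNReal.ofReal_mul (by positivity), mul_comm]
  have hCS2 : (∫⁻ s, ∫⁻ q, ((N s q).natAbs : ENNReal)) ^ 2 ≤
      ENNReal.ofReal (∑ σ ∈ E, |ψ (b σ) - ψ (a σ)| * |y (l σ) - y (k σ)|) *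
      (ENNReal.ofReal (∑ σ ∈ E, |ψ (b σ) - ψ (a σ)| * |x (l σ) - x (k σ)|) *
      ENNReal.ofReal A1) := by
    simp_rw [hsum] at hCS1
    have := lintegral_cs (μ := volume) _ _ _ (hsumM y).aemeasurable ((hsumM x).mul_const _).aemeasurable
      (Filter.Eventually.of_forall hCS1)
    rwa [lintegral_mul_const _ (hsumM x), hsumI, hsumI] at this
  -- volume
  obtain ⟨R, hR⟩ : ∃ R : ℝ, ∀ σ ∈ E, |x (k σ)| < R ∧ |y (k σ)| < R ∧ |x (l σ)| < R ∧ |y (l σ)| < R := by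
    refine ⟨∑ σ ∈ E, (|x (k σ)| + |y (k σ)| + |x (l σ)| + |y (l σ)|) + 1, fun σ hσ => ?_⟩
    have := Finset.single_le_sum (f := fun σ => (|x (k σ)| + |y (k σ)| + |x (l σ)| + |y (l σ)|))
      (fun σ _ => by positivity) hσ
    have h1 := abs_nonneg (x (k σ))
    have h2 := abs_nonneg (y (k σ))
    have h3 := abs_nonneg (x (l σ))
    have h4 := abs_nonneg (y (l σ))
    refine ⟨?_, ?_, ?_, ?_⟩ <;> linarith
  set B : Set (ℝ × ℝ) := Set.Ioo (-R) R ×ˢ Set.Ioo (-R) R with hB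
  have hBm : MeasurableSet B := measurableSet_Ioo.prod measurableSet_Ioo
  have hBf : volume B ≠ ⊤ := by
    rw [hB, Measure.volume_eq_prod, Measure.prod_prod, Real.volume_Ioo]
    exact ENNReal.mul_ne_top ENNReal.ofReal_ne_top ENNReal.ofReal_ne_top
  have hwri : ∀ p q : ℝ × ℝ, IntegrableOn (fun r => (wr p q r : ℝ)) B := by
    intro p q
    refine Measure.integrableOn_of_bounded (M := 1) hBf ?_ ?_
    · exact ((measurable_of_countable (fun n : ℤ => (n : ℝ))).comp (measurable_wr p q)).aestronglyMeasurable
    · refine Filter.Eventually.of_forall fun r => ?_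
      unfold wr; split_ifs <;> simp
  have hvol : ∫ s, ∫ q in B, (N s q : ℝ) = ∑ σ ∈ E, (ψ (b σ) - ψ (a σ)) *
      ((y (l σ) - y (k σ)) * ((x (k σ) + x (l σ)) / 2 + R)) := by
    have h1 : ∀ s, ∫ q in B, (N s q : ℝ) = ∑ σ ∈ E, (wchi (ψ (a σ)) (ψ (b σ)) s : ℝ) * 
      ((y (l σ) - y (k σ)) * ((x (k σ) + x (l σ)) / 2 + R)) := by
      intro s
      simp only [hN]; push_cast
      rw [integral_finsetSum _ fun σ _ => (hwri _ _).const_mul _]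
      refine Finset.sum_congr rfl fun σ hσ => ?_
      obtain ⟨h1, h2, h3, h4⟩ := hR σ hσ
      rw [integral_const_mul, integral_wr _ _ R h1 h2 h3 h4]
    simp_rw [h1]
    rw [integral_finsetSum _ fun σ _ => (integrable_wchi _ _).mul_const _]
    refine Finset.sum_congr rfl fun σ hσ => ?_
    rw [integral_mul_const, integral_wchi]
  have hvol2 : ∑ σ ∈ E, (ψ (b σ) - ψ (a σ)) *
      ((y (l σ) - y (k σ)) * ((x (k σ) + x (l σ)) / 2 + R)) = 
      (∑ σ ∈ E, (ψ (b σ) - ψ (a σ)) * (x (k σ) * y (l σ) - x (l σ) * y (k σ))) / 2 := by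
    have H1 := H ψ (fun t => R * y t + x t * y t / 2)
    rw [← sub_eq_zero, ← H1, Finset.sum_div, ← Finset.sum_sub_distrib]
    refine Finset.sum_congr rfl fun σ _ => ?_
    ring
  have hle : ‖∫ s, ∫ q in B, (N s q : ℝ)‖ₑ ≤ ∫⁻ s, ∫⁻ q, ((N s q).natAbs : ENNReal) := by
    refine (enorm_integral_le_lintegral_enorm _).trans (lintegral_mono fun s => ?_)
    refine (enorm_integral_le_lintegral_enorm _).trans ?_
    refine (setLIntegral_le_lintegral _ _).trans (lintegral_mono fun q => ?_)
    show ‖(N s q : ℝ)‖ₑ ≤ _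
    rw [← ofReal_norm, Real.norm_eq_abs, ← Int.cast_abs, Int.abs_eq_natAbs, Int.cast_natCast]
    exact (ENNReal.ofReal_natCast _).le
  rw [hvol, hvol2] at hle
  have hA1n : 0 ≤ A1 := Finset.sum_nonneg fun v _ => 
    mul_nonneg (Finset.sum_nonneg fun _ _ => abs_nonneg _) (Finset.sum_nonneg fun _ _ => abs_nonneg _)
  have hfin := (pow_le_pow_left' hle 2).trans hCS2
  rw [← ENNReal.ofReal_mul (Finset.sum_nonneg fun _ _ => by positivity),
    ← ENNReal.ofReal_mul (Finset.sum_nonneg fun _ _ => by positivity), ← ofReal_norm,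
    ← ENNReal.ofReal_pow (norm_nonneg _), ENNReal.ofReal_le_ofReal_iff] at hfin
  · rw [Real.norm_eq_abs, sq_abs] at hfin
    linarith
  · exact mul_nonneg (Finset.sum_nonneg fun _ _ => by positivity) (mul_nonneg (Finset.sum_nonneg fun _ _ => by positivity) hA1n)

end abstract_ineq

/-! ### Part 3 -/


lemma wD_affine (a b : ℝ × ℝ) (s s' r θ : ℝ) :
    wD a b ((1 - θ) * s + θ * s', r) = (1 - θ) * wD a b (s, r) + θ * wD a b (s', r) := by
  simp only [wD]; ring

/-- If the sign of `wD` changes along a horizontal segment at a height between `a` and `b`,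
then the segment is crossed. -/
lemma wr_cross (a b : ℝ × ℝ) (s s' r : ℝ) (h : wr a b (s, r) ≠ wr a b (s', r)) :
    ∃ θ : ℝ, 0 ≤ θ ∧ θ ≤ 1 ∧ ((1 - θ) * s + θ * s', r) ∈ segment ℝ a b := by
  -- zero of wD
  have key : (a.2 ≤ r ∧ r < b.2 ∨ b.2 ≤ r ∧ r < a.2) ∧
      (wD a b (s, r) * wD a b (s', r) ≤ 0) ∧ (wD a b (s, r) ≠ 0 ∨ wD a b (s', r) ≠ 0) := by
    unfold wr at h
    simp only at h
    generalize wD a b (s, r) = D at *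
    generalize wD a b (s', r) = D' at *
    by_cases h1 : a.2 ≤ r ∧ r < b.2
    · have h2 : ¬ (b.2 ≤ r ∧ r < a.2) := by intro h; linarith [h.1, h.2, h1.1, h1.2]
      refine ⟨Or.inl h1, ?_⟩
      by_cases h3 : 0 < D <;> by_cases h4 : 0 < D'
      · exfalso; apply h; simp [h1, h3, h4]
      · exact ⟨mul_nonpos_of_nonneg_of_nonpos h3.le (not_lt.1 h4), Or.inl h3.ne'⟩
      · exact ⟨mul_nonpos_of_nonpos_of_nonneg (not_lt.1 h3) h4.le, Or.inr h4.ne'⟩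
      · exfalso; apply h; grind
    · by_cases h2 : b.2 ≤ r ∧ r < a.2
      · refine ⟨Or.inr h2, ?_⟩
        by_cases h3 : D < 0 <;> by_cases h4 : D' < 0
        · exfalso; apply h; grind
        · exact ⟨mul_nonpos_of_nonpos_of_nonneg h3.le (not_lt.1 h4), Or.inl h3.ne⟩
        · exact ⟨mul_nonpos_of_nonneg_of_nonpos (not_lt.1 h3) h4.le, Or.inr h4.ne⟩
        · exfalso; apply h; grind
      · exfalso; apply h; grind
  obtain ⟨hr, hD, hD0⟩ := key
  obtain ⟨θ, h0, h1, hθ⟩ : ∃ θ : ℝ, 0 ≤ θ ∧ θ ≤ 1 ∧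
      (1 - θ) * wD a b (s, r) + θ * wD a b (s', r) = 0 := by
    generalize wD a b (s, r) = D at *
    generalize wD a b (s', r) = D' at *
    rcases le_or_gt 0 D with h | h
    · rcases h.eq_or_lt with h | h
      · exact ⟨0, le_refl _, by norm_num, by rw [← h]; ring⟩
      · have h' : D' ≤ 0 := by
          by_contra hc; push Not at hc; linarith [mul_pos h hc]
        have hp : 0 < D - D' := by linarith
        exact ⟨D / (D - D'), by positivity, by rw [div_le_one hp]; linarith, by field_simp; ring⟩
    · have h' : 0 ≤ D' := by
          by_contra hc; push Not at hc; linarith [mul_pos_of_neg_of_neg h hc]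
      have hp : 0 < D' - D := by linarith
      refine ⟨-D / (D' - D), div_nonneg (by linarith) hp.le, by rw [div_le_one hp]; linarith, by field_simp; ring⟩
  refine ⟨θ, h0, h1, ?_⟩
  rw [← wD_affine] at hθ
  generalize (1 - θ) * s + θ * s' = p at *
  have hne : b.2 - a.2 ≠ 0 := by
    intro h'
    rcases hr with h | h <;> linarith [h.1, h.2]
  rw [segment_eq_image]
  refine ⟨(r - a.2) / (b.2 - a.2), ?_, ?_⟩
  · rcases hr with h | h
    · have : 0 < b.2 - a.2 := by linarith
      exact ⟨div_nonneg (by linarith) this.le, by rw [div_le_one this]; linarith⟩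
    · have : b.2 - a.2 < 0 := by linarith
      exact ⟨div_nonneg_of_nonpos (by linarith) this.le, by rw [div_le_one_of_neg this]; linarith⟩
  · simp only [wD] at hθ
    ext
    · simp; field_simp; linarith
    · simp; field_simp; ring

lemma wr2_cross (a b : ℝ × ℝ) (s r r' : ℝ) (h : wr2 a b (s, r) ≠ wr2 a b (s, r')) :
    ∃ θ : ℝ, 0 ≤ θ ∧ θ ≤ 1 ∧ (s, (1 - θ) * r + θ * r') ∈ segment ℝ a b := by
  unfold wr2 at h
  obtain ⟨θ, h0, h1, h2⟩ := wr_cross a.swap b.swap r r' s (by simpa using h)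
  refine ⟨θ, h0, h1, ?_⟩
  rw [segment_eq_image] at h2 ⊢
  obtain ⟨τ, hτ, e⟩ := h2
  refine ⟨τ, hτ, ?_⟩
  have e1 := congrArg Prod.fst e
  have e2 := congrArg Prod.snd e
  simp at e1 e2
  ext
  · simpa using e2
  · simpa using e1

/-- Winding-type function of a real 1-cycle is constant on convex open sets missing its support. -/
lemma winding_const {ι : Type*} (E : Finset ι) (a b : ι → ℝ × ℝ) (c : ι → ℝ)
    (hc : ∀ h : ℝ × ℝ → ℝ, ∑ σ ∈ E, c σ * (h (b σ) - h (a σ)) = 0)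
    (U : Set (ℝ × ℝ)) (hU : IsOpen U) (hUc : Convex ℝ U)
    (hUE : ∀ σ ∈ E, c σ ≠ 0 → ∀ q ∈ U, q ∉ segment ℝ (a σ) (b σ))
    (q q' : ℝ × ℝ) (hq : q ∈ U) (hq' : q' ∈ U) :
    ∑ σ ∈ E, c σ * (wr (a σ) (b σ) q : ℝ) = ∑ σ ∈ E, c σ * (wr (a σ) (b σ) q' : ℝ) := by
  set n : ℝ × ℝ → ℝ := fun q => ∑ σ ∈ E, c σ * (wr (a σ) (b σ) q : ℝ) with hn
  have hn2 : ∀ q ∈ U, n q = ∑ σ ∈ E, c σ * (wr2 (a σ) (b σ) q : ℝ) := by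
    intro q hq
    rw [← sub_eq_zero, ← hc (fun p => (wh p q : ℝ)), hn, ← Finset.sum_sub_distrib]
    refine Finset.sum_congr rfl fun σ hσ => ?_
    by_cases h : c σ = 0
    · rw [h]; ring
    · have := wr_sub_of_notMem (a σ) (b σ) q (hUE σ hσ h q hq)
      have : (wr (a σ) (b σ) q : ℝ) - wr2 (a σ) (b σ) q = wh (b σ) q - wh (a σ) q := by exact_mod_cast this
      rw [← this]; ring
  have hloc : ∀ q ∈ U, ∀ᶠ q' in nhds q, n q' = n q := by
    intro q hq
    obtain ⟨ε, hε, hb⟩ := Metric.isOpen_iff.1 hU q hq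
    filter_upwards [Metric.ball_mem_nhds q hε] with q' hq'
    rw [Metric.mem_ball, Prod.dist_eq, max_lt_iff] at hq'
    have hcv : ∀ x y θ : ℝ, 0 ≤ θ → θ ≤ 1 → dist y x < ε → dist ((1 - θ) * x + θ * y) x < ε := by
      intro x y θ h0 h1 h
      rw [Real.dist_eq] at *
      have : (1 - θ) * x + θ * y - x = θ * (y - x) := by ring
      rw [this, abs_mul, abs_of_nonneg h0]
      nlinarith [abs_nonneg (y - x)]
    have hcv' : ∀ x y θ : ℝ, 0 ≤ θ → θ ≤ 1 → dist y x < ε → dist ((1 - θ) * y + θ * x) x < ε := by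
      intro x y θ h0 h1 h
      have := hcv x y (1 - θ) (by linarith) (by linarith) h
      rwa [show (1 - (1 - θ)) * x + (1 - θ) * y = (1 - θ) * y + θ * x by ring] at this
    have hmid : (q'.1, q.2) ∈ U := hb (by
      rw [Metric.mem_ball, Prod.dist_eq, max_lt_iff]; exact ⟨hq'.1, by simpa using hε⟩)
    have hq'U : q' ∈ U := hb (by
      rw [Metric.mem_ball, Prod.dist_eq, max_lt_iff]; exact hq')
    have h1 : n (q'.1, q.2) = n q := by
      simp only [hn]
      refine Finset.sum_congr rfl fun σ hσ => ?_
      by_cases h : c σ = 0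
      · rw [h]; ring
      · congr 2
        by_contra hne
        obtain ⟨θ, h0, h1, h2⟩ := wr_cross (a σ) (b σ) q'.1 q.1 q.2 hne
        refine hUE σ hσ h _ (hb ?_) h2
        rw [Metric.mem_ball, Prod.dist_eq, max_lt_iff]
        exact ⟨hcv' _ _ _ h0 h1 hq'.1, by simpa using hε⟩
    rw [← h1, hn2 _ hq'U, hn2 _ hmid]
    refine Finset.sum_congr rfl fun σ hσ => ?_
    by_cases h : c σ = 0
    · rw [h]; ring
    · congr 2
      by_contra hne
      obtain ⟨θ, h0, h1, h2⟩ := wr2_cross (a σ) (b σ) q'.1 q'.2 q.2 hne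
      refine hUE σ hσ h _ (hb ?_) h2
      rw [Metric.mem_ball, Prod.dist_eq, max_lt_iff]
      exact ⟨hq'.1, hcv' _ _ _ h0 h1 hq'.2⟩
  have hder : ∀ q ∈ U, HasFDerivAt n (0 : ℝ × ℝ →L[ℝ] ℝ) q := by
    intro q hq
    exact (hasFDerivAt_const (n q) q).congr_of_eventuallyEq (hloc q hq)
  exact hU.is_const_of_fderiv_eq_zero hUc.isPreconnected
    (fun q hq => (hder q hq).differentiableAt.differentiableWithinAt)
    (fun q hq => (hder q hq).fderiv) hq hq'

/-! ### Part 4 -/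


/-- Coordinates of a point of the plane. -/
def pr (x : E2) : ℝ × ℝ := (x 0, x 1)

/-- The point with the given coordinates. -/
def mkq : ℝ × ℝ →ₗ[ℝ] E2 where
  toFun q := !₂[q.1, q.2]
  map_add' x y := by ext i; fin_cases i <;> simp
  map_smul' r x := by ext i; fin_cases i <;> simp

@[simp] lemma mkq_zero' (q : ℝ × ℝ) : mkq q 0 = q.1 := rfl
@[simp] lemma mkq_one' (q : ℝ × ℝ) : mkq q 1 = q.2 := rfl
@[simp] lemma pr_mkq (q : ℝ × ℝ) : pr (mkq q) = q := rfl
@[simp] lemma mkq_pr (x : E2) : mkq (pr x) = x := by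
  ext i; fin_cases i <;> rfl
@[simp] lemma pr_fst (x : E2) : (pr x).1 = x 0 := rfl
@[simp] lemma pr_snd (x : E2) : (pr x).2 = x 1 := rfl

lemma continuous_mkq : Continuous mkq := LinearMap.continuous_of_finiteDimensional _
lemma continuous_pr : Continuous pr := by unfold pr; fun_prop

lemma pr_inj {x y : E2} (h : pr x = pr y) : x = y := by
  rw [← mkq_pr x, h, mkq_pr]

lemma mem_segment_pr {a b : E2} {q : ℝ × ℝ} (h : q ∈ segment ℝ (pr a) (pr b)) :
    mkq q ∈ segment ℝ a b := by
  rw [segment_eq_image] at h ⊢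
  obtain ⟨θ, hθ, rfl⟩ := h
  exact ⟨θ, hθ, by simp only [map_add, map_smul, mkq_pr]⟩

lemma perp_zero (x : E2) : perp x 0 = - x 1 := rfl
lemma perp_one (x : E2) : perp x 1 = x 0 := rfl

lemma inner_E2 (x y : E2) : ⟪x, y⟫ = x 0 * y 0 + x 1 * y 1 := by
  simp [PiLp.inner_apply, Fin.sum_univ_two]; ring

lemma norm_sq_E2 (x : E2) : ‖x‖ ^ 2 = x 0 ^ 2 + x 1 ^ 2 := by
  rw [EuclideanSpace.norm_sq_eq]; simp [Fin.sum_univ_two]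

lemma norm_perp (x : E2) : ‖perp x‖ = ‖x‖ := by
  have : ‖perp x‖ ^ 2 = ‖x‖ ^ 2 := by
    rw [norm_sq_E2, norm_sq_E2, perp_zero, perp_one]; ring
  exact (sq_eq_sq₀ (norm_nonneg _) (norm_nonneg _)).1 this

namespace Tri

lemma card_fin_rank : Fintype.card (Fin 3) = Module.finrank ℝ E2 + 1 := by simp

/-- The barycentric basis of a triangle. -/
def bas (t : Tri) : AffineBasis (Fin 3) ℝ E2 :=
  ⟨t.vtx, t.indep, (t.indep.affineSpan_eq_top_iff_card_eq_finrank_add_one).2 card_fin_rank⟩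

lemma bas_apply (t : Tri) (i : Fin 3) : t.bas i = t.vtx i := rfl

lemma mem_carrier (t : Tri) (x : E2) : x ∈ t.carrier ↔ ∀ i, 0 ≤ t.bas.coord i x := by
  have := t.bas.convexHull_eq_nonneg_coord
  have h2 : Set.range t.bas = Set.range t.vtx := rfl
  rw [h2] at this
  unfold carrier; rw [this]; rfl

lemma mem_interior (t : Tri) (x : E2) : x ∈ interior t.carrier ↔ ∀ i, 0 < t.bas.coord i x := by
  have := t.bas.interior_convexHull
  have h2 : Set.range t.bas = Set.range t.vtx := rfl
  rw [h2] at this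
  unfold carrier; rw [this]; rfl

lemma convex_carrier (t : Tri) : Convex ℝ t.carrier := convex_convexHull _ _

lemma interior_nonempty (t : Tri) : (interior t.carrier).Nonempty := by
  refine ⟨Finset.centroid ℝ Finset.univ t.bas, (t.mem_interior _).2 fun i => ?_⟩
  rw [AffineBasis.coord_apply_centroid _ (Finset.mem_univ i)]
  simp

lemma closure_interior (t : Tri) : t.carrier ⊆ closure (interior t.carrier) := by
  rw [t.convex_carrier.closure_interior_eq_closure_of_nonempty_interior t.interior_nonempty]
  exact subset_closure

lemma sum_coord (t : Tri) (x : E2) {i j k : Fin 3} (hij : i ≠ j) (hik : i ≠ k) (hjk : j ≠ k) :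
    t.bas.coord i x + t.bas.coord j x + t.bas.coord k x = 1 := by
  have h := t.bas.sum_coord_apply_eq_one x
  have hu : (Finset.univ : Finset (Fin 3)) = {i, j, k} := by
    revert i j k; decide
  rw [hu, Finset.sum_insert (by simp [hij, hik]), Finset.sum_pair hjk] at h
  linarith

lemma sum_coord_smul (t : Tri) (x : E2) {i j k : Fin 3} (hij : i ≠ j) (hik : i ≠ k) (hjk : j ≠ k) :
    x = t.bas.coord i x • t.vtx i + t.bas.coord j x • t.vtx j + t.bas.coord k x • t.vtx k := by
  have h := t.bas.linear_combination_coord_eq_self x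
  have hu : (Finset.univ : Finset (Fin 3)) = {i, j, k} := by
    revert i j k; decide
  rw [hu, Finset.sum_insert (by simp [hij, hik]), Finset.sum_pair hjk] at h
  rw [add_assoc]
  exact h.symm

lemma coord_mul (t : Tri) (x : E2) {i j k : Fin 3} (hij : i ≠ j) (hik : i ≠ k) (hjk : j ≠ k) :
    t.bas.coord k x * wD (pr (t.vtx i)) (pr (t.vtx j)) (pr (t.vtx k)) =
      wD (pr (t.vtx i)) (pr (t.vtx j)) (pr x) := by
  have h1 := t.sum_coord x hij hik hjk
  have h2 := t.sum_coord_smul x hij hik hjk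
  generalize t.bas.coord i x = α at *
  generalize t.bas.coord j x = β at *
  generalize t.bas.coord k x = γ at *
  obtain rfl : α = 1 - β - γ := by linarith
  rw [h2]
  simp [wD]; ring

lemma coord_vtx (t : Tri) (i j : Fin 3) : t.bas.coord i (t.vtx j) = if i = j then 1 else 0 := by
  rw [← bas_apply, AffineBasis.coord_apply]

lemma det_ne (t : Tri) {i j k : Fin 3} (hij : i ≠ j) (hik : i ≠ k) (hjk : j ≠ k) :
    wD (pr (t.vtx i)) (pr (t.vtx j)) (pr (t.vtx k)) ≠ 0 := by
  intro h
  -- all points would lie on the line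
  have hne : ∀ x, wD (pr (t.vtx i)) (pr (t.vtx j)) (pr x) = 0 := by
    intro x; rw [← t.coord_mul x hij hik hjk, h, mul_zero]
  have hx := hne (t.vtx i + perp (t.vtx j - t.vtx i))
  have : ‖t.vtx j - t.vtx i‖ ^ 2 = 0 := by
    rw [norm_sq_E2]
    simp [wD, perp_zero, perp_one] at hx ⊢
    linarith
  have h0 : t.vtx j - t.vtx i = 0 := by simpa using this
  exact hij (t.indep.injective (sub_eq_zero.1 h0).symm)

/-- The signed area determinant. -/
def det (t : Tri) : ℝ := wD (pr (t.vtx 0)) (pr (t.vtx 1)) (pr (t.vtx 2))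

lemma det_ne_zero (t : Tri) : t.det ≠ 0 := t.det_ne (by decide) (by decide) (by decide)

/-- Orientation sign. -/
def eps (t : Tri) : ℝ := if 0 < t.det then 1 else -1

lemma centroid_eq (t : Tri) : t.centroid = (3 : ℝ)⁻¹ • (t.vtx 0 + t.vtx 1 + t.vtx 2) := by
  unfold centroid
  rw [Finset.centroid_eq_affineCombination_fintype]
  rw [Finset.affineCombination_eq_linear_combination _ _ _ (Finset.sum_centroidWeightsIndicator_eq_one_of_card_ne_zero ℝ _ (by simp))]
  simp [Fin.sum_univ_three, Finset.centroidWeightsIndicator_def, Finset.centroidWeights]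

lemma centroid_eq' (t : Tri) {i j k : Fin 3} (hij : i ≠ j) (hik : i ≠ k) (hjk : j ≠ k) :
    t.centroid = (3 : ℝ)⁻¹ • (t.vtx i + t.vtx j + t.vtx k) := by
  have h : t.vtx 0 + t.vtx 1 + t.vtx 2 = ∑ i, t.vtx i := by rw [Fin.sum_univ_three]
  have hu : (Finset.univ : Finset (Fin 3)) = {i, j, k} := by
    revert i j k; decide
  rw [centroid_eq, h, hu, Finset.sum_insert (by simp [hij, hik]), Finset.sum_pair hjk, add_assoc]

/-- The incidence sign of an edge relative to a triangle. -/
def sgn (t : Tri) (σ : E2 × E2) : ℝ :=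
  if t.hasEdge σ then (if 0 ≤ ⟪perp (σ.2 - σ.1), emid σ - t.centroid⟫ then -1 else 1) else 0

lemma inner_mid (t : Tri) {i j k : Fin 3} (hij : i ≠ j) (hik : i ≠ k) (hjk : j ≠ k) :
    ⟪perp (t.vtx j - t.vtx i), emid (t.vtx i, t.vtx j) - t.centroid⟫ =
      - wD (pr (t.vtx i)) (pr (t.vtx j)) (pr (t.vtx k)) / 3 := by
  rw [t.centroid_eq' hij hik hjk, inner_E2, perp_zero, perp_one]
  simp [emid, midpoint_eq_smul_add, wD]; ring

lemma hasEdge_vtx (t : Tri) {i j : Fin 3} (hij : i ≠ j) : t.hasEdge (t.vtx i, t.vtx j) :=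
  ⟨fun h => hij (t.indep.injective h), ⟨i, rfl⟩, ⟨j, rfl⟩⟩

lemma hasEdge_idx (t : Tri) {σ : E2 × E2} (h : t.hasEdge σ) :
    ∃ i j k : Fin 3, i ≠ j ∧ i ≠ k ∧ j ≠ k ∧ σ = (t.vtx i, t.vtx j) := by
  obtain ⟨hne, ⟨i, hi⟩, ⟨j, hj⟩⟩ := h
  have hij : i ≠ j := by rintro rfl; exact hne (hi.symm.trans hj)
  obtain ⟨k, hk⟩ : ∃ k : Fin 3, i ≠ k ∧ j ≠ k := by
    have : ∀ i j : Fin 3, ∃ k, i ≠ k ∧ j ≠ k := by decide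
    exact this i j
  exact ⟨i, j, k, hij, hk.1, hk.2, Prod.ext hi.symm hj.symm⟩

lemma sgn_eq (t : Tri) {i j k : Fin 3} (hij : i ≠ j) (hik : i ≠ k) (hjk : j ≠ k) :
    t.sgn (t.vtx i, t.vtx j) = 
      if 0 < wD (pr (t.vtx i)) (pr (t.vtx j)) (pr (t.vtx k)) then 1 else -1 := by
  unfold sgn
  rw [if_pos (t.hasEdge_vtx hij), t.inner_mid hij hik hjk]
  have := t.det_ne hij hik hjk
  by_cases h : 0 < wD (pr (t.vtx i)) (pr (t.vtx j)) (pr (t.vtx k))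
  · rw [if_pos h, if_neg (by linarith)]
  · rw [if_neg h, if_pos (by linarith)]

lemma sgn_sq (t : Tri) {σ : E2 × E2} (h : t.hasEdge σ) : t.sgn σ * t.sgn σ = 1 := by
  unfold sgn; rw [if_pos h]; split_ifs <;> norm_num

lemma wD_cyc (a b c : ℝ × ℝ) : wD b c a = wD a b c := by simp only [wD]; ring
lemma wD_flip (a b c : ℝ × ℝ) : wD b a c = - wD a b c := by simp only [wD]; ring

lemma sgn_cyc (t : Tri) (i : Fin 3) : t.sgn (t.vtx i, t.vtx (i + 1)) = t.eps := by
  have h : i ≠ i + 1 ∧ i ≠ i + 2 ∧ i + 1 ≠ i + 2 := by revert i; decide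
  rw [t.sgn_eq h.1 h.2.1 h.2.2]
  unfold eps det
  fin_cases i
  · rfl
  · have : wD (pr (t.vtx 1)) (pr (t.vtx 2)) (pr (t.vtx 0)) = wD (pr (t.vtx 0)) (pr (t.vtx 1)) (pr (t.vtx 2)) := wD_cyc _ _ _
    rw [← this]; rfl
  · have : wD (pr (t.vtx 2)) (pr (t.vtx 0)) (pr (t.vtx 1)) = wD (pr (t.vtx 0)) (pr (t.vtx 1)) (pr (t.vtx 2)) := by
      rw [wD_cyc, wD_cyc]
    rw [← this]; rfl

lemma sgn_swap (t : Tri) (σ : E2 × E2) : t.sgn σ.swap = - t.sgn σ := by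
  by_cases h : t.hasEdge σ
  · obtain ⟨i, j, k, hij, hik, hjk, rfl⟩ := t.hasEdge_idx h
    rw [Prod.swap_prod_mk, t.sgn_eq hij hik hjk, t.sgn_eq hij.symm hjk hik, wD_flip]
    have := t.det_ne hij hik hjk
    rcases lt_or_gt_of_ne this with h | h
    · rw [if_pos (by linarith), if_neg (by linarith)]; norm_num
    · rw [if_neg (by linarith), if_pos (by linarith)]
  · have : ¬ t.hasEdge σ.swap := fun h' => h ⟨h'.1.symm, h'.2.2, h'.2.1⟩
    unfold sgn; rw [if_neg h, if_neg this]; simp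

lemma nrm_eq (t : Tri) {σ : E2 × E2} (h : t.hasEdge σ) :
    t.nrm σ = -(t.sgn σ * (elen σ)⁻¹) • perp (σ.2 - σ.1) := by
  unfold nrm sgn; rw [if_pos h]
  split_ifs
  · simp
  · simp

/-- winding of the boundary of a triangle -/
lemma wr_tri (t : Tri) (q : ℝ × ℝ) :
    (mkq q ∈ interior t.carrier → t.eps * ((wr (pr (t.vtx 0)) (pr (t.vtx 1)) q : ℝ) +
      wr (pr (t.vtx 1)) (pr (t.vtx 2)) q + wr (pr (t.vtx 2)) (pr (t.vtx 0)) q) = 1) ∧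
    (mkq q ∉ t.carrier → t.eps * ((wr (pr (t.vtx 0)) (pr (t.vtx 1)) q : ℝ) +
      wr (pr (t.vtx 1)) (pr (t.vtx 2)) q + wr (pr (t.vtx 2)) (pr (t.vtx 0)) q) = 0) := by
  have h01 : (0 : Fin 3) ≠ 1 := by decide
  have h02 : (0 : Fin 3) ≠ 2 := by decide
  have h12 : (1 : Fin 3) ≠ 2 := by decide
  have hs := t.sum_coord (mkq q) h01 h02 h12
  have hx := t.sum_coord_smul (mkq q) h01 h02 h12
  have hq : q = t.bas.coord 0 (mkq q) • pr (t.vtx 0) + t.bas.coord 1 (mkq q) • pr (t.vtx 1) + 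
      t.bas.coord 2 (mkq q) • pr (t.vtx 2) := by
    have e0 := congrArg (fun v : E2 => v 0) hx
    have e1 := congrArg (fun v : E2 => v 1) hx
    simp at e0 e1
    ext
    · simpa using e0
    · simpa using e1
  rw [t.mem_interior, t.mem_carrier]
  have hd := t.det_ne_zero
  unfold eps
  generalize t.bas.coord = cc at *
  rcases lt_or_gt_of_ne hd with h | h
  · rw [if_neg (by linarith)]
    have hd' : 0 < wD (pr (t.vtx 1)) (pr (t.vtx 0)) (pr (t.vtx 2)) := by
      rw [wD_flip]; unfold det at h; linarith
    constructor
    · intro hc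
      have := wr_tri_pos _ _ _ q (cc 1 (mkq q)) (cc 0 (mkq q)) (cc 2 (mkq q)) (by linarith)
        (by rw [add_comm (cc 1 (mkq q) • _)]; exact hq) hd' (hc 1) (hc 0) (hc 2)
      rw [wr_anti (pr (t.vtx 0)), wr_anti (pr (t.vtx 2)), wr_anti (pr (t.vtx 1)) (pr (t.vtx 2))] at this
      have : (-1 : ℤ) * (wr (pr (t.vtx 0)) (pr (t.vtx 1)) q +
        wr (pr (t.vtx 1)) (pr (t.vtx 2)) q + wr (pr (t.vtx 2)) (pr (t.vtx 0)) q) = 1 := by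
        linarith
      exact_mod_cast this
    · intro hc
      push Not at hc
      obtain ⟨i, hi⟩ := hc
      have := wr_tri_out _ _ _ q (cc 1 (mkq q)) (cc 0 (mkq q)) (cc 2 (mkq q)) (by linarith)
        (by rw [add_comm (cc 1 (mkq q) • _)]; exact hq) hd' (by clear hq hx hs; fin_cases i <;> simp at hi <;> simp [hi])
      rw [wr_anti (pr (t.vtx 0)), wr_anti (pr (t.vtx 2)), wr_anti (pr (t.vtx 1)) (pr (t.vtx 2))] at this
      have : (-1 : ℤ) * (wr (pr (t.vtx 0)) (pr (t.vtx 1)) q +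
        wr (pr (t.vtx 1)) (pr (t.vtx 2)) q + wr (pr (t.vtx 2)) (pr (t.vtx 0)) q) = 0 := by
        linarith
      exact_mod_cast this
  · rw [if_pos h]
    constructor
    · intro hc
      have := wr_tri_pos _ _ _ q _ _ _ hs hq h (hc 0) (hc 1) (hc 2)
      rw [one_mul]; exact_mod_cast this
    · intro hc
      push Not at hc
      obtain ⟨i, hi⟩ := hc
      have := wr_tri_out _ _ _ q _ _ _ hs hq h (by clear hq hx hs; fin_cases i <;> simp at hi <;> simp [hi])
      rw [one_mul]; exact_mod_cast this

end Tri

/-! ### Part 5 -/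


namespace Tri

lemma coord_segment (t : Tri) {i j k : Fin 3} (hik : i ≠ k) (hjk : j ≠ k) {x : E2}
    (hx : x ∈ segment ℝ (t.vtx i) (t.vtx j)) : t.bas.coord k x = 0 := by
  rw [segment_eq_image_lineMap] at hx
  obtain ⟨θ, hθ, rfl⟩ := hx
  rw [AffineMap.apply_lineMap, coord_vtx, coord_vtx, if_neg hik.symm, if_neg hjk.symm]
  simp [AffineMap.lineMap_apply]

lemma coord_mid (t : Tri) (l : Fin 3) {i j : Fin 3} (hij : i ≠ j) :
    t.bas.coord l (emid (t.vtx i, t.vtx j)) = if l = i ∨ l = j then 1 / 2 else 0 := by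
  unfold emid midpoint
  rw [AffineMap.apply_lineMap, coord_vtx, coord_vtx]
  by_cases h1 : l = i
  · subst h1; simp [hij, AffineMap.lineMap_apply]; norm_num
  · by_cases h2 : l = j
    · subst h2; simp [h1, AffineMap.lineMap_apply]
    · simp [h1, h2, AffineMap.lineMap_apply]

lemma eseg_sub (t : Tri) {σ : E2 × E2} (h : t.hasEdge σ) : eseg σ ⊆ t.carrier :=
  t.convex_carrier.segment_subset (subset_convexHull _ _ h.2.1) (subset_convexHull _ _ h.2.2)

lemma emid_mem (σ : E2 × E2) : emid σ ∈ eseg σ := midpoint_mem_segment _ _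

lemma eseg_swap (σ : E2 × E2) : eseg σ.swap = eseg σ := segment_symm _ _ _

/-- The midpoint of an edge lies on no other edge of the same triangle. -/
lemma mid_notMem (t : Tri) {σ τ : E2 × E2} (hσ : t.hasEdge σ) (hτ : t.hasEdge τ)
    (h : emid σ ∈ eseg τ) : τ = σ ∨ τ = σ.swap := by
  obtain ⟨i, j, k, hij, hik, hjk, rfl⟩ := t.hasEdge_idx hσ
  obtain ⟨i', j', k', hij', hik', hjk', rfl⟩ := t.hasEdge_idx hτ
  have h0 := t.coord_segment hik' hjk' h
  rw [t.coord_mid k' hij] at h0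
  have hk : ¬ (k' = i ∨ k' = j) := by
    intro h; rw [if_pos h] at h0; norm_num at h0
  have : (i' = i ∧ j' = j) ∨ (i' = j ∧ j' = i) := by
    clear h h0 hσ hτ; revert i j k i' j' k'; decide
  rcases this with ⟨rfl, rfl⟩ | ⟨rfl, rfl⟩
  · left; rfl
  · right; rfl

lemma mid_ne_vtx (t : Tri) {σ : E2 × E2} (hσ : t.hasEdge σ) (l : Fin 3) : emid σ ≠ t.vtx l := by
  obtain ⟨i, j, k, hij, hik, hjk, rfl⟩ := t.hasEdge_idx hσ
  intro h
  have h1 := t.coord_mid l hij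
  rw [h, t.coord_vtx, if_pos rfl] at h1
  split_ifs at h1 <;> norm_num at h1

/-- Two triangles with a common edge and third vertices on the same side have
intersecting interiors. -/
lemma same_side (t t' : Tri) {σ : E2 × E2} (h : t.hasEdge σ) (h' : t'.hasEdge σ)
    (hs : t.sgn σ = t'.sgn σ) : (interior t.carrier ∩ interior t'.carrier).Nonempty := by
  obtain ⟨i, j, k, hij, hik, hjk, rfl⟩ := t.hasEdge_idx h
  obtain ⟨i', j', k', hij', hik', hjk', e⟩ := t'.hasEdge_idx h'
  have e1 := (Prod.mk.inj e).1
  have e2 := (Prod.mk.inj e).2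
  set m := emid (t.vtx i, t.vtx j) with hm
  have hm' : m = emid (t'.vtx i', t'.vtx j') := by rw [hm, e]
  set x : ℝ → E2 := fun θ => AffineMap.lineMap m (t.vtx k) θ with hx
  have hxc : Continuous x := AffineMap.lineMap_continuous
  have hx0 : x 0 = m := by simp [hx]
  have hpos : ∀ (s : Tri) (l : Fin 3), 0 < s.bas.coord l m → 
      ∀ᶠ θ in nhdsWithin (0:ℝ) (Set.Ioi 0), 0 < s.bas.coord l (x θ) := by
    intro s l hl
    have hc : Continuous fun θ => s.bas.coord l (x θ) :=
      (s.bas.coord l).continuous_of_finiteDimensional.comp hxc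
    have h00 : 0 < (fun θ => s.bas.coord l (x θ)) 0 := by simp only [hx0]; exact hl
    have := (hc.tendsto 0).eventually (lt_mem_nhds h00)
    exact this.filter_mono nhdsWithin_le_nhds
  have hk : ∀ θ, t.bas.coord k (x θ) = θ := by
    intro θ
    simp only [hx]
    rw [AffineMap.apply_lineMap, hm, coord_mid _ _ hij, if_neg (by simp [hik.symm, hjk.symm]),
      coord_vtx, if_pos rfl]
    simp [AffineMap.lineMap_apply]
  have hk' : ∀ θ, 0 < θ → 0 < t'.bas.coord k' (x θ) := by
    intro θ hθ
    have c1 := t.coord_mul (x θ) hij hik hjk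
    have c2 := t'.coord_mul (x θ) hij' hik' hjk'
    rw [← e1, ← e2, ← c1, hk] at c2
    rw [t.sgn_eq hij hik hjk, e, t'.sgn_eq hij' hik' hjk'] at hs
    have d1 := t.det_ne hij hik hjk
    have d2 := t'.det_ne hij' hik' hjk'
    rw [← e1, ← e2] at hs d2
    generalize wD (pr (t.vtx i)) (pr (t.vtx j)) (pr (t.vtx k)) = D at *
    generalize wD (pr (t.vtx i)) (pr (t.vtx j)) (pr (t'.vtx k')) = D' at *
    generalize t'.bas.coord k' (x θ) = α at *
    by_contra hα
    push Not at hα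
    rcases lt_or_gt_of_ne d1 with h1 | h1 <;> rcases lt_or_gt_of_ne d2 with h2 | h2
    · nlinarith [mul_neg_of_pos_of_neg hθ h1, mul_nonneg_of_nonpos_of_nonpos hα h2.le]
    · rw [if_neg (by linarith), if_pos (by linarith)] at hs; norm_num at hs
    · rw [if_pos (by linarith), if_neg (by linarith)] at hs; norm_num at hs
    · nlinarith [mul_pos hθ h1, mul_nonpos_of_nonpos_of_nonneg hα h2.le]
  have hall : ∀ᶠ θ in nhdsWithin (0:ℝ) (Set.Ioi 0), 
      (∀ l, 0 < t.bas.coord l (x θ)) ∧ (∀ l, 0 < t'.bas.coord l (x θ)) := by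
    rw [Filter.eventually_and, Filter.eventually_all, Filter.eventually_all]
    constructor
    · intro l
      by_cases hl : l = k
      · subst hl
        filter_upwards [self_mem_nhdsWithin] with θ hθ
        rw [hk]; exact hθ
      · apply hpos
        rw [hm, coord_mid _ _ hij, if_pos]
        · norm_num
        · have : ∀ i j k l : Fin 3, i ≠ j → i ≠ k → j ≠ k → l ≠ k → l = i ∨ l = j := by decide
          exact this i j k l hij hik hjk hl
    · intro l
      by_cases hl : l = k'
      · subst hl
        filter_upwards [self_mem_nhdsWithin] with θ hθ
        exact hk' θ hθ
      · apply hpos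
        rw [hm', coord_mid _ _ hij', if_pos]
        · norm_num
        · have : ∀ i j k l : Fin 3, i ≠ j → i ≠ k → j ≠ k → l ≠ k → l = i ∨ l = j := by decide
          exact this i' j' k' l hij' hik' hjk' hl
  obtain ⟨θ, h1, h2⟩ := hall.exists
  exact ⟨x θ, (t.mem_interior _).2 h1, (t'.mem_interior _).2 h2⟩

end Tri

namespace Mesh

variable {Ω : Set E2} (M : Mesh Ω)

lemma carrier_disj {t s : Tri} (ht : t ∈ M.tris) (hs : s ∈ M.tris) (h : t ≠ s) {x : E2}
    (hx : x ∈ interior t.carrier) : x ∉ s.carrier := by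
  intro hxs
  have hcl := s.closure_interior hxs
  rw [mem_closure_iff] at hcl
  obtain ⟨y, hy⟩ := hcl _ isOpen_interior hx
  have := M.interior_disjoint t ht s hs h
  rw [← Set.mem_empty_iff_false y, ← this]
  exact hy

/-- (G1) interiors of triangles miss all the edges. -/
lemma edge_notMem {t : Tri} (ht : t ∈ M.tris) {σ : E2 × E2} (hσ : σ ∈ M.edges) {x : E2}
    (hx : x ∈ interior t.carrier) : x ∉ eseg σ := by
  intro hxs
  obtain ⟨s, hs, hsσ⟩ := M.edges_sub σ hσ
  by_cases h : t = s
  · subst h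
    obtain ⟨i, j, k, hij, hik, hjk, rfl⟩ := t.hasEdge_idx hsσ
    have := t.coord_segment hik hjk hxs
    have h2 := (t.mem_interior x).1 hx k
    linarith
  · exact M.carrier_disj ht hs h hx (s.eseg_sub hsσ hxs)

/-- (G2) midpoints of edges lie on no other edge. -/
lemma mid_notMem {σ τ : E2 × E2} (hσ : σ ∈ M.edges) (hτ : τ ∈ M.edges) (hne : τ ≠ σ) :
    emid σ ∉ eseg τ := by
  intro h
  obtain ⟨s, hs, hsτ⟩ := M.edges_sub τ hτ
  obtain ⟨hK, hKσ⟩ := M.Kof_mem σ hσ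
  have key : s.hasEdge σ := by
    by_cases hsK : M.Kof σ = s
    · rwa [← hsK]
    have hm : emid σ ∈ (M.Kof σ).carrier ∩ s.carrier :=
      ⟨(M.Kof σ).eseg_sub hKσ (Tri.emid_mem σ), s.eseg_sub hsτ h⟩
    rcases M.inter_structure _ hK s hs hsK with h0 | ⟨a, ha, h0⟩ | ⟨ρ, hρ, hρ', h0⟩
    · rw [h0] at hm; exact hm.elim
    · rw [h0] at hm
      obtain ⟨l, hl⟩ := ha.1
      exact ((M.Kof σ).mid_ne_vtx hKσ l (by rw [hl]; exact hm)).elim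
    · rw [h0] at hm
      rcases (M.Kof σ).mid_notMem hKσ hρ hm with rfl | rfl
      · exact hρ'
      · exact ⟨hKσ.1, hρ'.2.2, hρ'.2.1⟩
  rcases s.mid_notMem key hsτ h with h1 | h1
  · exact hne h1
  · exact M.edges_orient σ hσ (h1 ▸ hτ)

lemma mem_int {σ : E2 × E2} : σ ∈ M.intEdges ↔ σ ∈ M.edges ∧ (M.tris.filter fun t => t.hasEdge σ).card = 2 := by
  unfold intEdges; rw [Finset.mem_filter]

lemma mem_ext {σ : E2 × E2} : σ ∈ M.extEdges ↔ σ ∈ M.edges ∧ (M.tris.filter fun t => t.hasEdge σ).card = 1 := by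
  unfold extEdges; rw [Finset.mem_filter]

lemma int_or_ext {σ : E2 × E2} (hσ : σ ∈ M.edges) : σ ∈ M.intEdges ∨ σ ∈ M.extEdges := by
  have h1 := M.edges_atMostTwo σ hσ
  have h2 : 0 < (M.tris.filter fun t => t.hasEdge σ).card := by
    rw [Finset.card_pos]
    exact ⟨M.Kof σ, Finset.mem_filter.2 (M.Kof_mem σ hσ)⟩
  rw [mem_int, mem_ext]
  have : (M.tris.filter fun t => t.hasEdge σ).card = 2 ∨ (M.tris.filter fun t => t.hasEdge σ).card = 1 := by omega
  tauto

lemma int_ext_disj : Disjoint M.intEdges M.extEdges := by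
  rw [Finset.disjoint_left]
  intro σ h1 h2
  rw [mem_int] at h1; rw [mem_ext] at h2
  omega

lemma union_edges : M.intEdges ∪ M.extEdges = M.edges := by
  ext σ
  rw [Finset.mem_union]
  constructor
  · rintro (h | h)
    · exact (M.mem_int.1 h).1
    · exact (M.mem_ext.1 h).1
  · exact M.int_or_ext

lemma filter_int {σ : E2 × E2} (hσ : σ ∈ M.intEdges) :
    (M.tris.filter fun t => t.hasEdge σ) = {M.Kof σ, M.Lof σ} := by
  obtain ⟨h1, h2⟩ := M.mem_int.1 hσ
  have hK := M.Kof_mem σ h1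
  have hL := M.Lof_mem σ h1 h2
  symm
  apply Finset.eq_of_subset_of_card_le
  · intro t ht
    simp only [Finset.mem_insert, Finset.mem_singleton] at ht
    rcases ht with rfl | rfl
    · exact Finset.mem_filter.2 hK
    · exact Finset.mem_filter.2 ⟨hL.1, hL.2.1⟩
  · rw [h2, Finset.card_pair hL.2.2.symm]

lemma filter_ext {σ : E2 × E2} (hσ : σ ∈ M.extEdges) :
    (M.tris.filter fun t => t.hasEdge σ) = {M.Kof σ} := by
  obtain ⟨h1, h2⟩ := M.mem_ext.1 hσ
  have hK := M.Kof_mem σ h1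
  symm
  apply Finset.eq_of_subset_of_card_le
  · intro t ht
    rw [Finset.mem_singleton] at ht
    subst ht
    exact Finset.mem_filter.2 hK
  · rw [h2, Finset.card_singleton]

lemma sum_tris_int {σ : E2 × E2} (hσ : σ ∈ M.intEdges) (g : Tri → ℝ) :
    ∑ t ∈ M.tris, t.sgn σ * g t = (M.Kof σ).sgn σ * g (M.Kof σ) + (M.Lof σ).sgn σ * g (M.Lof σ) := by
  obtain ⟨h1, h2⟩ := M.mem_int.1 hσ
  rw [← Finset.sum_filter_of_ne (p := fun t => t.hasEdge σ), M.filter_int hσ,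
    Finset.sum_pair (M.Lof_mem σ h1 h2).2.2.symm]
  intro t _ h
  by_contra hc
  apply h; unfold Tri.sgn; rw [if_neg hc, zero_mul]

lemma sum_tris_ext {σ : E2 × E2} (hσ : σ ∈ M.extEdges) (g : Tri → ℝ) :
    ∑ t ∈ M.tris, t.sgn σ * g t = (M.Kof σ).sgn σ * g (M.Kof σ) := by
  rw [← Finset.sum_filter_of_ne (p := fun t => t.hasEdge σ), M.filter_ext hσ,
    Finset.sum_singleton]
  intro t _ h
  by_contra hc
  apply h; unfold Tri.sgn; rw [if_neg hc, zero_mul]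

lemma sgn_L {σ : E2 × E2} (hσ : σ ∈ M.intEdges) : (M.Lof σ).sgn σ = - (M.Kof σ).sgn σ := by
  obtain ⟨h1, h2⟩ := M.mem_int.1 hσ
  have hK := M.Kof_mem σ h1
  have hL := M.Lof_mem σ h1 h2
  have hne : (M.Lof σ).sgn σ ≠ (M.Kof σ).sgn σ := by
    intro h
    have := (M.Lof σ).same_side (M.Kof σ) hL.2.1 hK.2 h
    rw [M.interior_disjoint _ hL.1 _ hK.1 hL.2.2] at this
    exact Set.not_nonempty_empty this
  have a1 := (M.Lof σ).sgn_sq hL.2.1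
  have a2 := (M.Kof σ).sgn_sq hK.2
  have : ((M.Lof σ).sgn σ - (M.Kof σ).sgn σ) * ((M.Lof σ).sgn σ + (M.Kof σ).sgn σ) = 0 := by linarith
  rcases mul_eq_zero.1 this with h | h
  · exact (hne (by linarith)).elim
  · linarith

/-- The edge-sum lemma. -/
lemma edge_sum {t : Tri} (ht : t ∈ M.tris) (g : E2 → E2 → ℝ) (hg : ∀ a b, g b a = - g a b) :
    ∑ σ ∈ M.edges, t.sgn σ * g σ.1 σ.2 = t.eps * (g (t.vtx 0) (t.vtx 1) + g (t.vtx 1) (t.vtx 2) +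
      g (t.vtx 2) (t.vtx 0)) := by
  set F : E2 × E2 → ℝ := fun σ => t.sgn σ * g σ.1 σ.2 with hF
  have hFs : ∀ σ, F σ.swap = F σ := by
    intro σ; simp only [hF]; rw [t.sgn_swap, Prod.fst_swap, Prod.snd_swap, hg]; ring
  set e : Fin 3 → E2 × E2 := fun i => if (t.vtx i, t.vtx (i + 1)) ∈ M.edges then (t.vtx i, t.vtx (i + 1))
    else (t.vtx i, t.vtx (i + 1)).swap with he
  have hee : ∀ i, e i = (t.vtx i, t.vtx (i + 1)) ∨ e i = (t.vtx i, t.vtx (i + 1)).swap := by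
    intro i; simp only [he]; split_ifs
    · left; rfl
    · right; rfl
  have hFe : ∀ i, F (e i) = F (t.vtx i, t.vtx (i + 1)) := by
    intro i
    rcases hee i with h | h
    · rw [h]
    · rw [h, hFs]
  have hem : ∀ i, e i ∈ M.edges := by
    intro i
    have hi : i ≠ i + 1 := by revert i; decide
    simp only [he]
    split_ifs with h
    · exact h
    · exact (M.edges_cover t ht i (i + 1) hi).resolve_left h
  have hinj : Function.Injective e := by
    intro i j hij
    have hv := t.indep.injective
    have key : ∀ i j : Fin 3, (i = j ∧ i + 1 = j + 1) ∨ (i = j + 1 ∧ i + 1 = j) → i = j := by decide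
    apply key
    rcases hee i with h | h <;> rcases hee j with h' | h' <;> rw [h, h'] at hij
    · left; exact ⟨hv (Prod.mk.inj hij).1, hv (Prod.mk.inj hij).2⟩
    · right; exact ⟨hv (Prod.mk.inj hij).1, hv (Prod.mk.inj hij).2⟩
    · right; exact ⟨hv (Prod.mk.inj hij).2, hv (Prod.mk.inj hij).1⟩
    · left; exact ⟨hv (Prod.mk.inj hij).2, hv (Prod.mk.inj hij).1⟩
  have hfilt : (M.edges.filter fun σ => t.hasEdge σ) = Finset.univ.image e := by
    ext σ
    rw [Finset.mem_filter, Finset.mem_image]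
    constructor
    · rintro ⟨hσ, hσt⟩
      obtain ⟨i, j, k, hij, hik, hjk, rfl⟩ := t.hasEdge_idx hσt
      have : j = i + 1 ∨ i = j + 1 := by clear * - hij; revert i j; decide
      rcases this with rfl | rfl
      · exact ⟨i, Finset.mem_univ _, by simp only [he]; rw [if_pos hσ]⟩
      · refine ⟨j, Finset.mem_univ _, ?_⟩
        simp only [he]; rw [if_neg]
        · rfl
        · exact M.edges_orient _ hσ
    · rintro ⟨i, _, rfl⟩
      refine ⟨hem i, ?_⟩
      have hi : i ≠ i + 1 := by revert i; decide
      rcases hee i with h | h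
      · rw [h]; exact t.hasEdge_vtx hi
      · rw [h]; exact t.hasEdge_vtx hi.symm
  have h1 : ∑ σ ∈ M.edges, F σ = ∑ σ ∈ M.edges.filter (fun σ => t.hasEdge σ), F σ := by
    symm
    apply Finset.sum_filter_of_ne
    intro σ _ h
    by_contra hc
    apply h; simp only [hF]; unfold Tri.sgn; rw [if_neg hc, zero_mul]
  rw [h1, hfilt, Finset.sum_image (fun i _ j _ h => hinj h)]
  simp_rw [hFe, hF, t.sgn_cyc]
  rw [← Finset.mul_sum, Fin.sum_univ_three]
  rfl

end Mesh

/-! ### Part 6 -/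


namespace Mesh

variable {Ω : Set E2} (M : Mesh Ω)

lemma tri_winding {t : Tri} (ht : t ∈ M.tris) (q : ℝ × ℝ) :
    (mkq q ∈ interior t.carrier → ∑ σ ∈ M.edges, t.sgn σ * (wr (pr σ.1) (pr σ.2) q : ℝ) = 1) ∧
    (mkq q ∉ t.carrier → ∑ σ ∈ M.edges, t.sgn σ * (wr (pr σ.1) (pr σ.2) q : ℝ) = 0) := by
  rw [M.edge_sum ht (fun a b => (wr (pr a) (pr b) q : ℝ)) (fun a b => by rw [wr_anti]; push_cast; ring)]
  exact t.wr_tri q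

lemma tri_cycle {t : Tri} (ht : t ∈ M.tris) (h : E2 → ℝ) :
    ∑ σ ∈ M.edges, t.sgn σ * (h σ.2 - h σ.1) = 0 := by
  rw [M.edge_sum ht (fun a b => h b - h a) (fun a b => by ring)]
  ring

/-- The winding function of a chain. -/
def wind (c : E2 × E2 → ℝ) (q : ℝ × ℝ) : ℝ := ∑ σ ∈ M.edges, c σ * (wr (pr σ.1) (pr σ.2) q : ℝ)

lemma wind_const {c : E2 × E2 → ℝ} (hc : ∀ h : E2 → ℝ, ∑ σ ∈ M.edges, c σ * (h σ.2 - h σ.1) = 0)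
    {U : Set E2} (hU : IsOpen U) (hUc : Convex ℝ U)
    (hUE : ∀ σ ∈ M.edges, c σ ≠ 0 → ∀ x ∈ U, x ∉ eseg σ) {x y : E2} (hx : x ∈ U) (hy : y ∈ U) :
    M.wind c (pr x) = M.wind c (pr y) := by
  refine winding_const M.edges (fun σ => pr σ.1) (fun σ => pr σ.2) c (fun h => hc (fun x => h (pr x)))
    (mkq ⁻¹' U) (hU.preimage continuous_mkq) (hUc.linear_preimage mkq) ?_ _ _ (by simpa using hx) (by simpa using hy)
  intro σ hσ h0 q hq hq2
  exact hUE σ hσ h0 _ hq (mem_segment_pr hq2)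

/-- The jump relation. -/
lemma wind_jump {c : E2 × E2 → ℝ} (hc : ∀ h : E2 → ℝ, ∑ σ ∈ M.edges, c σ * (h σ.2 - h σ.1) = 0)
    {σ₀ : E2 × E2} (hσ : σ₀ ∈ M.intEdges) {x y : E2} (hx : x ∈ interior (M.Kof σ₀).carrier)
    (hy : y ∈ interior (M.Lof σ₀).carrier) :
    c σ₀ = (M.Kof σ₀).sgn σ₀ * M.wind c (pr x) + (M.Lof σ₀).sgn σ₀ * M.wind c (pr y) := by
  obtain ⟨h1, h2⟩ := M.mem_int.1 hσ
  obtain ⟨hK, hKe⟩ := M.Kof_mem σ₀ h1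
  obtain ⟨hL, hLe, hne⟩ := M.Lof_mem σ₀ h1 h2
  set K := M.Kof σ₀ with hKd
  set L := M.Lof σ₀ with hLd
  have hKK := K.sgn_sq hKe
  set c' : E2 × E2 → ℝ := fun σ => c σ - c σ₀ * K.sgn σ₀ * K.sgn σ with hc'
  have hc'0 : c' σ₀ = 0 := by simp only [hc']; rw [mul_assoc, hKK]; ring
  have hcc' : ∀ h : E2 → ℝ, ∑ σ ∈ M.edges, c' σ * (h σ.2 - h σ.1) = 0 := by
    intro h
    have a1 := hc h
    have a2 := M.tri_cycle hK h
    have : ∑ σ ∈ M.edges, c' σ * (h σ.2 - h σ.1) = ∑ σ ∈ M.edges, c σ * (h σ.2 - h σ.1) -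
        c σ₀ * K.sgn σ₀ * ∑ σ ∈ M.edges, K.sgn σ * (h σ.2 - h σ.1) := by
      rw [Finset.mul_sum, ← Finset.sum_sub_distrib]
      refine Finset.sum_congr rfl fun σ _ => ?_
      simp only [hc']; ring
    rw [this, a1, a2]; ring
  have hw : ∀ q, M.wind c' q = M.wind c q - c σ₀ * K.sgn σ₀ * ∑ σ ∈ M.edges, K.sgn σ * (wr (pr σ.1) (pr σ.2) q : ℝ) := by
    intro q
    unfold wind
    rw [Finset.mul_sum, ← Finset.sum_sub_distrib]
    refine Finset.sum_congr rfl fun σ _ => ?_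
    simp only [hc']; ring
  -- a ball around the midpoint
  set C : Set E2 := ⋃ σ ∈ M.edges.erase σ₀, eseg σ with hC
  have hCc : IsClosed C := by
    apply Set.Finite.isClosed_biUnion (Finset.finite_toSet _)
    intro σ _
    rw [eseg, segment_eq_image_lineMap]
    exact (isCompact_Icc.image AffineMap.lineMap_continuous).isClosed
  have hmC : emid σ₀ ∈ Cᶜ := by
    simp only [hC, Set.mem_compl_iff, Set.mem_iUnion, not_exists]
    intro σ hσ'
    rw [Finset.mem_erase] at hσ'
    exact M.mid_notMem h1 hσ'.2 hσ'.1
  obtain ⟨ε, hε, hball⟩ := Metric.isOpen_iff.1 hCc.isOpen_compl _ hmC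
  have hUE : ∀ σ ∈ M.edges, c' σ ≠ 0 → ∀ x ∈ Metric.ball (emid σ₀) ε, x ∉ eseg σ := by
    intro σ hσ' h0 x hx hxs
    have hne : σ ≠ σ₀ := by rintro rfl; exact h0 hc'0
    apply hball hx
    simp only [hC, Set.mem_iUnion]
    exact ⟨σ, Finset.mem_erase.2 ⟨hne, hσ'⟩, hxs⟩
  have hpt : ∀ t : Tri, t.hasEdge σ₀ → ∃ z ∈ interior t.carrier, z ∈ Metric.ball (emid σ₀) ε := by
    intro t ht
    have := t.closure_interior (t.eseg_sub ht (Tri.emid_mem σ₀))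
    obtain ⟨z, hz, hz'⟩ := Metric.mem_closure_iff.1 this ε hε
    exact ⟨z, hz, by rwa [Metric.mem_ball, dist_comm]⟩
  obtain ⟨z, hz, hzb⟩ := hpt K hKe
  obtain ⟨z', hz', hzb'⟩ := hpt L hLe
  have e1 := M.wind_const hcc' Metric.isOpen_ball (convex_ball _ _) hUE hzb hzb'
  have e2 : M.wind c (pr x) = M.wind c (pr z) := M.wind_const hc isOpen_interior K.convex_carrier.interior
    (fun σ hσ _ x hx => M.edge_notMem hK hσ hx) hx hz
  have e3 : M.wind c (pr y) = M.wind c (pr z') := M.wind_const hc isOpen_interior L.convex_carrier.interior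
    (fun σ hσ _ x hx => M.edge_notMem hL hσ hx) hy hz'
  rw [hw, hw, (M.tri_winding hK (pr z)).1 (by simpa using hz), 
    (M.tri_winding hK (pr z')).2 (by simpa using M.carrier_disj hL hK hne hz')] at e1
  have hs := M.sgn_L hσ
  rw [← hLd, ← hKd] at hs
  rw [hs, e2, e3]
  have : M.wind c (pr z) - M.wind c (pr z') = c σ₀ * K.sgn σ₀ := by linarith
  calc c σ₀ = c σ₀ * (K.sgn σ₀ * K.sgn σ₀) := by rw [hKK, mul_one]
    _ = K.sgn σ₀ * (M.wind c (pr z) - M.wind c (pr z')) := by rw [this]; ring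
    _ = _ := by ring

lemma cycle_orth {c f : E2 × E2 → ℝ} (hc : ∀ h : E2 → ℝ, ∑ σ ∈ M.edges, c σ * (h σ.2 - h σ.1) = 0)
    (hext : ∀ σ ∈ M.extEdges, f σ = 0) (hf : ∀ t ∈ M.tris, ∑ σ ∈ M.edges, t.sgn σ * f σ = 0) :
    ∑ σ ∈ M.edges, c σ * f σ = 0 := by
  set n : Tri → ℝ := fun t => M.wind c (pr t.interior_nonempty.some) with hn
  have h1 : ∀ σ ∈ M.edges, c σ * f σ = ∑ t ∈ M.tris, n t * (t.sgn σ * f σ) := by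
    intro σ hσ
    rcases M.int_or_ext hσ with h | h
    · have a1 := M.wind_jump hc h (M.Kof σ).interior_nonempty.some_mem (M.Lof σ).interior_nonempty.some_mem
      have a2 := M.sum_tris_int h (fun t => n t * f σ)
      calc c σ * f σ = ((M.Kof σ).sgn σ * n (M.Kof σ) + (M.Lof σ).sgn σ * n (M.Lof σ)) * f σ := by rw [a1]
        _ = ∑ t ∈ M.tris, t.sgn σ * (n t * f σ) := by rw [a2]; ring
        _ = _ := Finset.sum_congr rfl fun t _ => by ring
    · rw [hext σ h]; simp
  rw [Finset.sum_congr rfl h1, Finset.sum_comm]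
  refine Finset.sum_eq_zero fun t ht => ?_
  rw [← Finset.mul_sum, hf t ht, mul_zero]

/-- Existence of a stream function. -/
lemma exists_stream {f : E2 × E2 → ℝ} 
    (hext : ∀ σ ∈ M.extEdges, f σ = 0) (hf : ∀ t ∈ M.tris, ∑ σ ∈ M.edges, t.sgn σ * f σ = 0) :
    ∃ ψ : E2 → ℝ, ∀ σ ∈ M.edges, ψ σ.2 - ψ σ.1 = f σ := by
  set δ : (E2 → ℝ) →ₗ[ℝ] (M.edges → ℝ) :=
    { toFun := fun ψ σ => ψ σ.1.2 - ψ σ.1.1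
      map_add' := fun x y => by ext σ; simp; ring
      map_smul' := fun r x => by ext σ; simp; ring } with hδ
  set F : M.edges → ℝ := fun σ => f σ.1 with hF
  by_cases hmem : F ∈ LinearMap.range δ
  · obtain ⟨ψ, hψ⟩ := hmem
    exact ⟨ψ, fun σ hσ => congrFun hψ ⟨σ, hσ⟩⟩
  exfalso
  obtain ⟨g, hg, hle⟩ := Submodule.exists_le_ker_of_notMem hmem
  have hgs : ∀ x : M.edges → ℝ, g x = ∑ σ, x σ * g (Pi.single σ 1) := by
    intro x
    rw [LinearMap.pi_apply_eq_sum_univ g x]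
    refine Finset.sum_congr rfl fun σ _ => ?_
    rw [smul_eq_mul]; congr 2
    ext τ; simp [Pi.single_apply, eq_comm]
  set c : E2 × E2 → ℝ := fun σ => if h : σ ∈ M.edges then g (Pi.single ⟨σ, h⟩ 1) else 0 with hc
  have hsum : ∀ y : E2 × E2 → ℝ, g (fun σ => y σ.1) = ∑ σ ∈ M.edges, c σ * y σ := by
    intro y
    rw [hgs, ← Finset.sum_coe_sort M.edges]
    refine Finset.sum_congr rfl fun σ _ => ?_
    simp only [hc]
    rw [dif_pos σ.2, mul_comm]
  apply hg
  rw [hF, hsum]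
  refine M.cycle_orth (fun h => ?_) hext hf
  have : g (δ h) = 0 := hle ⟨h, rfl⟩
  rw [← hsum (fun σ => h σ.2 - h σ.1)]
  exact this

end Mesh

/-! ### Part 7 -/



lemma quad_zero {r m q x1 y1 x2 y2 : ℝ} (hd : x1 * y2 - x2 * y1 ≠ 0)
    (h1 : r * x1 ^ 2 + m * x1 * y1 - q * y1 ^ 2 = 0)
    (h2 : r * x2 ^ 2 + m * x2 * y2 - q * y2 ^ 2 = 0)
    (h3 : r * (x2 - x1) ^ 2 + m * (x2 - x1) * (y2 - y1) - q * (y2 - y1) ^ 2 = 0) :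
    r = 0 ∧ m = 0 ∧ q = 0 := by
  have hd2 : (x1 * y2 - x2 * y1) ^ 2 ≠ 0 := pow_ne_zero 2 hd
  refine ⟨?_, ?_, ?_⟩
  · apply (mul_eq_zero.mp (?_ : (x1 * y2 - x2 * y1) ^ 2 * r = 0)).resolve_left hd2
    linear_combination y2 ^ 2 * h1 + y1 ^ 2 * h2 - y1 * y2 * (h1 + h2 - h3)
  · apply (mul_eq_zero.mp (?_ : (x1 * y2 - x2 * y1) ^ 2 * m = 0)).resolve_left hd2
    linear_combination (-2 * x2 * y2) * h1 - 2 * x1 * y1 * h2 + (x1 * y2 + x2 * y1) * (h1 + h2 - h3)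
  · apply (mul_eq_zero.mp (?_ : (x1 * y2 - x2 * y1) ^ 2 * q = 0)).resolve_left hd2
    linear_combination (-x2 ^ 2) * h1 - x1 ^ 2 * h2 + (x1 * x2) * (h1 + h2 - h3)

lemma lin_zero (A : E2 →ₗ[ℝ] E2) (htr : LinearMap.trace ℝ E2 A = 0) {e f : E2}
    (hd : e 0 * f 1 - f 0 * e 1 ≠ 0) (h1 : ⟪A e, perp e⟫ = 0) (h2 : ⟪A f, perp f⟫ = 0)
    (h3 : ⟪A (f - e), perp (f - e)⟫ = 0) : A = 0 := by
  set p := A (mkq (1, 0)) 0 with hp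
  set q := A (mkq (0, 1)) 0 with hq
  set r := A (mkq (1, 0)) 1 with hr
  set s := A (mkq (0, 1)) 1 with hs
  have hdec : ∀ x : E2, x = x 0 • mkq (1, 0) + x 1 • mkq (0, 1) := by
    intro x; ext i; fin_cases i <;> simp
  have hA : ∀ x : E2, A x = x 0 • A (mkq (1, 0)) + x 1 • A (mkq (0, 1)) := by
    intro x
    conv_lhs => rw [hdec x]
    simp
  have hA0 : ∀ x : E2, A x 0 = x 0 * p + x 1 * q := by
    intro x; rw [hA x]; simp [hp, hq]
  have hA1 : ∀ x : E2, A x 1 = x 0 * r + x 1 * s := by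
    intro x; rw [hA x]; simp [hr, hs]
  have htr' : p + s = 0 := by
    rw [LinearMap.trace_eq_matrix_trace ℝ (EuclideanSpace.basisFun (Fin 2) ℝ).toBasis,
      Matrix.trace_fin_two, LinearMap.toMatrix_apply, LinearMap.toMatrix_apply] at htr
    simp only [OrthonormalBasis.coe_toBasis, EuclideanSpace.basisFun_apply,
      OrthonormalBasis.coe_toBasis_repr_apply, EuclideanSpace.basisFun_repr] at htr
    rw [hA0, hA1] at htr
    simpa using htr
  have key : ∀ x : E2, ⟪A x, perp x⟫ = 0 → r * x 0 ^ 2 + (s - p) * x 0 * x 1 - q * x 1 ^ 2 = 0 := by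
    intro x hx
    rw [inner_E2, hA0, hA1, perp_zero, perp_one] at hx
    linear_combination hx
  have k3 := key _ h3
  simp only [PiLp.sub_apply] at k3
  obtain ⟨r0, m0, q0⟩ := quad_zero hd (key _ h1) (key _ h2) k3
  have p0 : p = 0 := by linarith
  have s0 : s = 0 := by linarith
  ext x i
  fin_cases i
  · simp [hA0, p0, q0]
  · simp [hA1, r0, s0]

namespace Mesh

variable {Ω : Set E2} (M : Mesh Ω)

lemma elen_pos {σ : E2 × E2} (hσ : σ ∈ M.edges) : 0 < elen σ := dist_pos.mpr (M.edges_ne σ hσ)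

variable {u : Tri → (E2 →ᵃ[ℝ] E2)}

lemma rt_edge (hu : M.IsRT0 u) {t : Tri} (ht : t ∈ M.tris) {σ : E2 × E2} (hσ : σ ∈ M.edges) (h : t.hasEdge σ) :
    ⟪(u t).linear (σ.2 - σ.1), perp (σ.2 - σ.1)⟫ = 0 := by
  have h1 := hu.1 t ht σ hσ h σ.1 (left_mem_segment _ _ _)
  have h2 := hu.1 t ht σ hσ h σ.2 (right_mem_segment _ _ _)
  have h3 : ⟪u t σ.2 - u t σ.1, t.nrm σ⟫ = 0 := by rw [inner_sub_left]; linarith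
  have h4 : (u t).linear (σ.2 - σ.1) = u t σ.2 - u t σ.1 := by
    simpa using (u t).linearMap_vsub σ.2 σ.1
  rw [h4]
  rw [t.nrm_eq h, inner_smul_right] at h3
  refine (mul_eq_zero.mp h3).resolve_left ?_
  have := M.elen_pos hσ
  have h5 := t.sgn_sq h
  have h6 : t.sgn σ ≠ 0 := by intro h0; rw [h0] at h5; norm_num at h5
  exact neg_ne_zero.mpr (mul_ne_zero h6 (inv_ne_zero this.ne'))

lemma rt_edge' (hu : M.IsRT0 u) {t : Tri} (ht : t ∈ M.tris) {i j : Fin 3} (hij : i ≠ j) :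
    ⟪(u t).linear (t.vtx j - t.vtx i), perp (t.vtx j - t.vtx i)⟫ = 0 := by
  rcases M.edges_cover t ht i j hij with h | h
  · exact M.rt_edge (σ := (t.vtx i, t.vtx j)) hu ht h (t.hasEdge_vtx hij)
  · have : ⟪(u t).linear (t.vtx i - t.vtx j), perp (t.vtx i - t.vtx j)⟫ = 0 :=
      M.rt_edge (σ := (t.vtx j, t.vtx i)) hu ht h (t.hasEdge_vtx hij.symm)
    have e : t.vtx j - t.vtx i = -(t.vtx i - t.vtx j) := by abel
    have e2 : perp (-(t.vtx i - t.vtx j)) = - perp (t.vtx i - t.vtx j) := by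
      ext k; fin_cases k <;> simp [perp]
    rw [e, map_neg, e2, inner_neg_neg, this]

lemma rt_lin (hu : M.IsRT0 u) (hdiv : ∀ t ∈ M.tris, divA (u t) = 0)
    {t : Tri} (ht : t ∈ M.tris) : (u t).linear = 0 := by
  refine lin_zero _ (hdiv t ht) (e := t.vtx 1 - t.vtx 0) (f := t.vtx 2 - t.vtx 0) ?_
    (M.rt_edge' hu ht (by decide)) (M.rt_edge' hu ht (by decide)) ?_
  · have := t.det_ne_zero
    simp only [Tri.det, wD, pr_fst, pr_snd] at this
    intro h; apply this
    simp only [PiLp.sub_apply] at h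
    linear_combination h
  · have := M.rt_edge' hu ht (i := 1) (j := 2) (by decide)
    rwa [sub_sub_sub_cancel_right]

lemma rt_const (hu : M.IsRT0 u) (hdiv : ∀ t ∈ M.tris, divA (u t) = 0)
    {t : Tri} (ht : t ∈ M.tris) (x y : E2) : u t x = u t y := by
  have h4 : (u t).linear (x - y) = u t x - u t y := by
    simpa using (u t).linearMap_vsub x y
  rw [M.rt_lin hu hdiv ht] at h4
  exact (sub_eq_zero.mp h4.symm)

/-- The stream-function increments. -/
def flx (u : Tri → (E2 →ᵃ[ℝ] E2)) (σ : E2 × E2) : ℝ := ⟪u (M.Kof σ) 0, perp (σ.2 - σ.1)⟫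

lemma unrm_eq (hu : M.IsRT0 u) (hdiv : ∀ t ∈ M.tris, divA (u t) = 0)
    {t : Tri} (ht : t ∈ M.tris) {σ : E2 × E2} (hσ : σ ∈ M.edges) (h : t.hasEdge σ) :
    elen σ * unrm u t σ = - (t.sgn σ * ⟪u t 0, perp (σ.2 - σ.1)⟫) := by
  unfold unrm
  rw [M.rt_const hu hdiv ht _ 0, t.nrm_eq h, inner_smul_right]
  have := (M.elen_pos hσ).ne'
  field_simp

lemma unrm_K (hu : M.IsRT0 u) (hdiv : ∀ t ∈ M.tris, divA (u t) = 0)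
    {σ : E2 × E2} (hσ : σ ∈ M.edges) :
    elen σ * unrm u (M.Kof σ) σ = - ((M.Kof σ).sgn σ * M.flx u σ) :=
  M.unrm_eq hu hdiv (M.Kof_mem σ hσ).1 hσ (M.Kof_mem σ hσ).2

lemma edges_of_int {σ : E2 × E2} (hσ : σ ∈ M.intEdges) : σ ∈ M.edges := (M.mem_int.mp hσ).1
lemma edges_of_ext {σ : E2 × E2} (hσ : σ ∈ M.extEdges) : σ ∈ M.edges := (M.mem_ext.mp hσ).1
lemma L_mem {σ : E2 × E2} (hσ : σ ∈ M.intEdges) : M.Lof σ ∈ M.tris := 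
  (M.Lof_mem σ (M.edges_of_int hσ) (M.mem_int.mp hσ).2).1
lemma L_edge {σ : E2 × E2} (hσ : σ ∈ M.intEdges) : (M.Lof σ).hasEdge σ := 
  (M.Lof_mem σ (M.edges_of_int hσ) (M.mem_int.mp hσ).2).2.1
lemma L_ne {σ : E2 × E2} (hσ : σ ∈ M.intEdges) : M.Lof σ ≠ M.Kof σ := 
  (M.Lof_mem σ (M.edges_of_int hσ) (M.mem_int.mp hσ).2).2.2

lemma sgn_ne {t : Tri} {σ : E2 × E2} (h : t.hasEdge σ) : t.sgn σ ≠ 0 := by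
  have h5 := t.sgn_sq h
  intro h0; rw [h0] at h5; norm_num at h5

lemma flx_L (hu : M.IsRT0 u) (hdiv : ∀ t ∈ M.tris, divA (u t) = 0)
    {σ : E2 × E2} (hσ : σ ∈ M.intEdges) :
    ⟪u (M.Lof σ) 0, perp (σ.2 - σ.1)⟫ = M.flx u σ := by
  have hE := M.edges_of_int hσ
  have h := hu.2.1 σ hσ
  rw [M.rt_const hu hdiv (M.Kof_mem σ hE).1 _ 0, M.rt_const hu hdiv (M.L_mem hσ) _ 0,
    Tri.nrm_eq _ (M.Kof_mem σ hE).2, inner_smul_right, inner_smul_right] at h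
  refine (mul_left_cancel₀ ?_ h).symm
  exact neg_ne_zero.mpr (mul_ne_zero (sgn_ne (M.Kof_mem σ hE).2) (inv_ne_zero (M.elen_pos hE).ne'))

lemma flx_ext (hu : M.IsRT0 u) (hdiv : ∀ t ∈ M.tris, divA (u t) = 0)
    {σ : E2 × E2} (hσ : σ ∈ M.extEdges) : M.flx u σ = 0 := by
  have hE := M.edges_of_ext hσ
  have h := M.unrm_K hu hdiv hE
  rw [hu.2.2 σ hσ, mul_zero] at h
  exact (mul_eq_zero.mp (neg_eq_zero.mp h.symm)).resolve_left (sgn_ne (M.Kof_mem σ hE).2)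

lemma flx_t (hu : M.IsRT0 u) (hdiv : ∀ t ∈ M.tris, divA (u t) = 0)
    {t : Tri} (ht : t ∈ M.tris) {σ : E2 × E2} (hσ : σ ∈ M.edges) (h : t.hasEdge σ) :
    ⟪u t 0, perp (σ.2 - σ.1)⟫ = M.flx u σ := by
  have hm : t ∈ M.tris.filter fun t => t.hasEdge σ := by simp [ht, h]
  rcases M.int_or_ext hσ with h1 | h1
  · rw [M.filter_int h1] at hm
    simp only [Finset.mem_insert, Finset.mem_singleton] at hm
    rcases hm with rfl | rfl
    · rfl
    · exact M.flx_L hu hdiv h1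
  · rw [M.filter_ext h1] at hm
    simp only [Finset.mem_singleton] at hm
    subst hm; rfl

lemma flx_sum (hu : M.IsRT0 u) (hdiv : ∀ t ∈ M.tris, divA (u t) = 0)
    {t : Tri} (ht : t ∈ M.tris) : ∑ σ ∈ M.edges, t.sgn σ * M.flx u σ = 0 := by
  have h := M.edge_sum ht (fun a b => ⟪u t 0, perp (b - a)⟫) (by
    intro a b; simp only [inner_E2, perp_zero, perp_one, PiLp.sub_apply]; ring)
  have h2 : t.eps * (⟪u t 0, perp (t.vtx 1 - t.vtx 0)⟫ + ⟪u t 0, perp (t.vtx 2 - t.vtx 1)⟫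
     + ⟪u t 0, perp (t.vtx 0 - t.vtx 2)⟫) = 0 := by
    simp only [inner_E2, perp_zero, perp_one, PiLp.sub_apply]; ring
  rw [h2] at h
  rw [← h]
  refine Finset.sum_congr rfl fun σ hσ => ?_
  by_cases hE : t.hasEdge σ
  · rw [M.flx_t hu hdiv ht hσ hE]
  · simp [Tri.sgn, hE]

lemma flx_stream (hu : M.IsRT0 u) (hdiv : ∀ t ∈ M.tris, divA (u t) = 0)
    : ∃ ψ : E2 → ℝ, ∀ σ ∈ M.edges, ψ σ.2 - ψ σ.1 = M.flx u σ :=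
  M.exists_stream (fun σ hσ => M.flx_ext hu hdiv hσ) (fun t ht => M.flx_sum hu hdiv ht)

end Mesh

/-! ### Part 8 -/



/-- A reference ball inside the reference triangle. -/
def rball : Set E2 := Metric.ball (mkq (1 / 4, 1 / 4)) (1 / 8)

/-- The area of the reference ball. -/
def c0 : ℝ := (volume rball).toReal

lemma c0_pos : 0 < c0 := by
  refine ENNReal.toReal_pos (Metric.measure_ball_pos _ _ (by norm_num)).ne' ?_
  exact measure_ball_lt_top.ne

/-- The area of the unit ball. -/
def c1 : ℝ := (volume (Metric.closedBall (0 : E2) 1)).toReal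

lemma abs_coord_le (x : E2) (i : Fin 2) : |x i| ≤ ‖x‖ := by
  simpa using PiLp.norm_apply_le x i

namespace Tri

/-- The linear part of the map from the reference triangle. -/
def lmap (t : Tri) : E2 →ₗ[ℝ] E2 where
  toFun y := y 0 • (t.vtx 1 - t.vtx 0) + y 1 • (t.vtx 2 - t.vtx 0)
  map_add' x y := by simp only [PiLp.add_apply, add_smul]; abel
  map_smul' r x := by simp only [PiLp.smul_apply, smul_eq_mul, mul_smul, smul_add, RingHom.id_apply]

lemma lmap_apply (t : Tri) (y : E2) :
    t.lmap y = y 0 • (t.vtx 1 - t.vtx 0) + y 1 • (t.vtx 2 - t.vtx 0) := rfl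

lemma det_lmap (t : Tri) : LinearMap.det t.lmap = t.det := by
  rw [← LinearMap.det_toMatrix (EuclideanSpace.basisFun (Fin 2) ℝ).toBasis, Matrix.det_fin_two]
  simp only [LinearMap.toMatrix_apply, OrthonormalBasis.coe_toBasis, EuclideanSpace.basisFun_apply,
      OrthonormalBasis.coe_toBasis_repr_apply, EuclideanSpace.basisFun_repr, lmap_apply]
  simp [det, wD]
  ring

lemma lmap_mem (t : Tri) {y : E2} (hy : y ∈ rball) : t.vtx 0 + t.lmap y ∈ interior t.carrier := by
  have hy0 := (abs_coord_le (y - mkq (1/4, 1/4)) 0).trans_lt (mem_ball_iff_norm.mp hy)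
  have hy1 := (abs_coord_le (y - mkq (1/4, 1/4)) 1).trans_lt (mem_ball_iff_norm.mp hy)
  simp only [PiLp.sub_apply, mkq_zero', mkq_one', abs_lt] at hy0 hy1
  have hd := t.det_ne_zero
  set x := t.vtx 0 + t.lmap y with hx
  have x0 : x 0 = t.vtx 0 0 + (y 0 * (t.vtx 1 0 - t.vtx 0 0) + y 1 * (t.vtx 2 0 - t.vtx 0 0)) := by
    simp [hx, lmap_apply]
  have x1 : x 1 = t.vtx 0 1 + (y 0 * (t.vtx 1 1 - t.vtx 0 1) + y 1 * (t.vtx 2 1 - t.vtx 0 1)) := by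
    simp [hx, lmap_apply]
  have h2 : t.bas.coord 2 x = y 1 := by
    have h := t.coord_mul x (i := 0) (j := 1) (k := 2) (by decide) (by decide) (by decide)
    refine mul_right_cancel₀ hd (h.trans ?_)
    simp only [det, wD, pr_fst, pr_snd, x0, x1]; ring
  have h1 : t.bas.coord 1 x = y 0 := by
    have h := t.coord_mul x (i := 2) (j := 0) (k := 1) (by decide) (by decide) (by decide)
    rw [wD_cyc, wD_cyc] at h
    refine mul_right_cancel₀ hd (Eq.trans ?_ (h.trans ?_))
    · rw [← wD_cyc]; simp only [det, wD]; ring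
    simp only [det, wD, pr_fst, pr_snd, x0, x1]; ring
  have h0 : t.bas.coord 0 x = 1 - y 0 - y 1 := by
    have h := t.sum_coord x (i := 0) (j := 1) (k := 2) (by decide) (by decide) (by decide)
    linarith
  rw [mem_interior]
  intro i
  fin_cases i
  · show 0 < t.bas.coord 0 x
    rw [h0]; linarith
  · show 0 < t.bas.coord 1 x
    rw [h1]; linarith
  · show 0 < t.bas.coord 2 x
    rw [h2]; linarith

lemma isCompact_carrier (t : Tri) : IsCompact t.carrier :=
  (Set.finite_range t.vtx).isCompact_convexHull (𝕜 := ℝ)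

lemma vol_lt_top (t : Tri) : volume t.carrier < ⊤ := t.isCompact_carrier.measure_lt_top

lemma vol_int (t : Tri) : c0 * |t.det| ≤ (volume (interior t.carrier)).toReal := by
  have h1 : (fun z => t.vtx 0 + z) '' (t.lmap '' rball) ⊆ interior t.carrier := by
    rintro _ ⟨_, ⟨y, hy, rfl⟩, rfl⟩
    exact t.lmap_mem hy
  have h2 := measure_mono (μ := volume) h1
  rw [Set.image_add_left, measure_preimage_add, Measure.addHaar_image_linearMap, det_lmap] at h2
  have h3 := ENNReal.toReal_mono
    ((measure_mono interior_subset).trans_lt t.vol_lt_top).ne h2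
  rw [ENNReal.toReal_mul, ENNReal.toReal_ofReal (abs_nonneg _)] at h3
  rw [mul_comm]; exact h3

lemma vol_area (t : Tri) : (volume (interior t.carrier)).toReal ≤ t.area :=
  ENNReal.toReal_mono t.vol_lt_top.ne (measure_mono interior_subset)

lemma area_pos (t : Tri) : 0 < t.area :=
  (mul_pos c0_pos (abs_pos.mpr t.det_ne_zero)).trans_le (t.vol_int.trans t.vol_area)

lemma dist_cc (t : Tri) (i : Fin 3) : dist (t.vtx i) t.ccenter = t.simplex.circumradius :=
  t.simplex.dist_circumcenter_eq_circumradius i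

lemma R_pos (t : Tri) : 0 < t.simplex.circumradius := t.simplex.circumradius_pos

lemma det_sin (t : Tri) : |t.det| * (2 * t.simplex.circumradius) =
    dist (t.vtx 1) (t.vtx 0) * dist (t.vtx 2) (t.vtx 0) * dist (t.vtx 1) (t.vtx 2) := by
  have h := Affine.Triangle.dist_div_sin_angle_eq_two_mul_circumradius t.simplex
    (i₁ := 1) (i₂ := 0) (i₃ := 2) (by decide) (by decide) (by decide)
  change dist (t.vtx 1) (t.vtx 2) / Real.sin (EuclideanGeometry.angle (t.vtx 1) (t.vtx 0) (t.vtx 2)) = _ at h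
  have h2 := InnerProductGeometry.sin_angle_mul_norm_mul_norm (t.vtx 1 - t.vtx 0) (t.vtx 2 - t.vtx 0)
  have h3 : Real.sqrt (⟪t.vtx 1 - t.vtx 0, t.vtx 1 - t.vtx 0⟫ * ⟪t.vtx 2 - t.vtx 0, t.vtx 2 - t.vtx 0⟫
      - ⟪t.vtx 1 - t.vtx 0, t.vtx 2 - t.vtx 0⟫ * ⟪t.vtx 1 - t.vtx 0, t.vtx 2 - t.vtx 0⟫) = |t.det| := by
    rw [← Real.sqrt_sq_eq_abs]; congr 1
    simp only [inner_E2, PiLp.sub_apply, det, wD, pr_fst, pr_snd]; ring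
  rw [h3] at h2
  unfold EuclideanGeometry.angle at h
  simp only [vsub_eq_sub] at h
  set s := Real.sin (InnerProductGeometry.angle (t.vtx 1 - t.vtx 0) (t.vtx 2 - t.vtx 0))
  have hs : s ≠ 0 := by
    intro h0
    rw [h0, zero_mul] at h2
    exact abs_ne_zero.mpr t.det_ne_zero h2.symm
  rw [dist_eq_norm (t.vtx 1) (t.vtx 0), dist_eq_norm (t.vtx 2) (t.vtx 0), ← h2, ← h]
  field_simp

end Tri

namespace Mesh

variable {Ω : Set E2} (M : Mesh Ω)

lemma two_R_le {t : Tri} (ht : t ∈ M.tris) : 2 * t.simplex.circumradius ≤ M.meshSize :=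
  Finset.le_sup' (fun t : Tri => 2 * t.simplex.circumradius) ht

lemma meshSize_pos : 0 < M.meshSize := by
  obtain ⟨t, ht⟩ := M.tris_nonempty
  have := M.two_R_le ht
  have := t.R_pos
  linarith

lemma dist_le_h {t : Tri} (ht : t ∈ M.tris) (i j : Fin 3) : dist (t.vtx i) (t.vtx j) ≤ M.meshSize := by
  have h1 := t.dist_cc i
  have h2 := t.dist_cc j
  have h3 := dist_triangle_right (t.vtx i) (t.vtx j) t.ccenter
  have := M.two_R_le ht
  linarith

lemma elen_le {σ : E2 × E2} (hσ : σ ∈ M.edges) : elen σ ≤ M.meshSize := by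
  obtain ⟨hK, h⟩ := M.Kof_mem σ hσ
  obtain ⟨-, ⟨i, hi⟩, ⟨j, hj⟩⟩ := h
  unfold elen
  rw [← hi, ← hj]
  exact M.dist_le_h hK i j

lemma dOf_le {σ : E2 × E2} (hσ : σ ∈ M.edges) : M.dOf σ ≤ M.meshSize := by
  obtain ⟨hK, h⟩ := M.Kof_mem σ hσ
  obtain ⟨-, ⟨i, hi⟩, ⟨j, hj⟩⟩ := h
  have hR := M.two_R_le hK
  have hp := (M.Kof σ).R_pos
  have h1 := (M.Kof σ).dist_cc i
  have h2 := (M.Kof σ).dist_cc j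
  rw [hi] at h1
  rw [hj] at h2
  unfold dOf
  split_ifs with hc
  · obtain ⟨hL, ⟨-, ⟨k, hk⟩, -⟩, -⟩ := M.Lof_mem σ hσ hc
    have hR' := M.two_R_le hL
    have h3 := (M.Lof σ).dist_cc k
    rw [hk] at h3
    have := dist_triangle_left (M.Kof σ).ccenter (M.Lof σ).ccenter σ.1
    linarith
  · have hm : emid σ ∈ Metric.closedBall (M.Kof σ).ccenter (M.Kof σ).simplex.circumradius :=
      (convex_closedBall _ _).segment_subset (Metric.mem_closedBall.mpr h1.le)
        (Metric.mem_closedBall.mpr h2.le) (Tri.emid_mem σ)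
    rw [Metric.mem_closedBall, dist_comm] at hm
    linarith

variable {Creg : ℝ} 

lemma le_tau (hC : 0 < Creg) (hM : M.Regular Creg) {σ : E2 × E2} (hσ : σ ∈ M.edges) :
    Creg ≤ M.tau σ := by
  obtain ⟨h1, h2⟩ := hM σ hσ
  have h3 := M.dOf_le hσ
  have hd : 0 < M.dOf σ := (mul_pos hC (M.elen_pos hσ)).trans_le h1
  unfold tau
  rw [le_div_iff₀ hd]
  exact (mul_le_mul_of_nonneg_left h3 hC.le).trans h2

lemma le_dist (hM : M.Regular Creg) {t : Tri} (ht : t ∈ M.tris) {i j : Fin 3} (hij : i ≠ j) :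
    Creg * M.meshSize ≤ dist (t.vtx i) (t.vtx j) := by
  rcases M.edges_cover t ht i j hij with h | h
  · exact (hM _ h).2
  · rw [dist_comm]; exact (hM _ h).2

lemma le_det (hC : 0 < Creg) (hM : M.Regular Creg) {t : Tri} (ht : t ∈ M.tris) :
    Creg ^ 3 * M.meshSize ^ 2 ≤ |t.det| := by
  have hh := M.meshSize_pos
  have h0 := mul_pos hC hh
  have h1 := M.le_dist hM ht (i := 1) (j := 0) (by decide)
  have h2 := M.le_dist hM ht (i := 2) (j := 0) (by decide)
  have h3 := M.le_dist hM ht (i := 1) (j := 2) (by decide)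
  have h4 := t.det_sin
  have h5 : |t.det| * (2 * t.simplex.circumradius) ≤ |t.det| * M.meshSize :=
    mul_le_mul_of_nonneg_left (M.two_R_le ht) (abs_nonneg _)
  have h6 : (Creg * M.meshSize) * (Creg * M.meshSize) * (Creg * M.meshSize) ≤
    dist (t.vtx 1) (t.vtx 0) * dist (t.vtx 2) (t.vtx 0) * dist (t.vtx 1) (t.vtx 2) := by gcongr
  refine le_of_mul_le_mul_right ?_ hh
  calc _ = (Creg * M.meshSize) * (Creg * M.meshSize) * (Creg * M.meshSize) := by ring
    _ ≤ _ := by linarith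

lemma le_vol (hC : 0 < Creg) (hM : M.Regular Creg) {t : Tri} (ht : t ∈ M.tris) :
    c0 * Creg ^ 3 * M.meshSize ^ 2 ≤ (volume (interior t.carrier)).toReal := by
  refine le_trans ?_ t.vol_int
  rw [mul_assoc]
  exact mul_le_mul_of_nonneg_left (M.le_det hC hM ht) c0_pos.le

lemma carrier_sub {t : Tri} (ht : t ∈ M.tris) (i : Fin 3) :
    t.carrier ⊆ Metric.closedBall (t.vtx i) M.meshSize := by
  refine convexHull_min ?_ (convex_closedBall _ _)
  rintro _ ⟨j, rfl⟩
  exact Metric.mem_closedBall.mpr (M.dist_le_h ht j i)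

lemma tri_degree (hC : 0 < Creg) (hM : M.Regular Creg) (v : E2) :
    ((M.tris.filter fun t => v ∈ Set.range t.vtx).card : ℝ) ≤ c1 / (c0 * Creg ^ 3) := by
  set N := M.tris.filter fun t => v ∈ Set.range t.vtx with hN
  have hh := M.meshSize_pos
  have hk : 0 < c0 * Creg ^ 3 := mul_pos c0_pos (pow_pos hC 3)
  have hsub : (⋃ t ∈ N, interior t.carrier) ⊆ Metric.closedBall v M.meshSize := by
    refine Set.iUnion₂_subset fun t ht => ?_
    obtain ⟨ht, ⟨i, hi⟩⟩ := Finset.mem_filter.mp ht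
    rw [← hi]
    exact interior_subset.trans (M.carrier_sub ht i)
  have hdisj : (N : Set Tri).PairwiseDisjoint fun t => interior t.carrier := by
    intro t ht s hs hts
    exact Set.disjoint_iff_inter_eq_empty.mpr (M.interior_disjoint t (Finset.mem_filter.mp ht).1 s
      (Finset.mem_filter.mp hs).1 hts)
  have h1 := measure_mono (μ := volume) hsub
  rw [measure_biUnion_finset hdisj (fun t _ => isOpen_interior.measurableSet),
    Measure.addHaar_closedBall _ _ hh.le, Measure.addHaar_ball_center] at h1
  have h2 := ENNReal.toReal_mono (ENNReal.mul_ne_top ENNReal.ofReal_ne_top measure_ball_lt_top.ne) h1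
  rw [ENNReal.toReal_sum, ENNReal.toReal_mul, ENNReal.toReal_ofReal (by positivity)] at h2
  swap
  · intro t _; exact ((measure_mono interior_subset).trans_lt t.vol_lt_top).ne
  have h3 : (volume (Metric.ball (0 : E2) 1)).toReal ≤ c1 :=
    ENNReal.toReal_mono measure_closedBall_lt_top.ne (measure_mono Metric.ball_subset_closedBall)
  have h4 : (N.card : ℝ) * (c0 * Creg ^ 3 * M.meshSize ^ 2) ≤ ∑ t ∈ N, (volume (interior t.carrier)).toReal := by
    rw [← nsmul_eq_mul]
    exact Finset.card_nsmul_le_sum _ _ _ fun t ht => M.le_vol hC hM (Finset.mem_filter.mp ht).1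
  simp only [finrank_euclideanSpace, Fintype.card_fin] at h2
  rw [le_div_iff₀ hk]
  refine le_of_mul_le_mul_right ?_ (pow_pos hh 2)
  have h5 := mul_le_mul_of_nonneg_left h3 (pow_pos hh 2).le
  linarith

lemma edges_tri_card (t : Tri) : (M.edges.filter fun σ => t.hasEdge σ).card ≤ 9 := by
  have : (M.edges.filter fun σ => t.hasEdge σ) ⊆
      (Finset.univ : Finset (Fin 3 × Fin 3)).image fun p => (t.vtx p.1, t.vtx p.2) := by
    intro σ hσ
    obtain ⟨-, -, ⟨i, hi⟩, ⟨j, hj⟩⟩ := Finset.mem_filter.mp hσ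
    exact Finset.mem_image.mpr ⟨(i, j), Finset.mem_univ _, by rw [hi, hj]⟩
  exact (Finset.card_le_card this).trans (Finset.card_image_le.trans (by simp))

lemma edge_degree (hC : 0 < Creg) (hM : M.Regular Creg) (v : E2) :
    ((M.edges.filter fun σ => σ.1 = v ∨ σ.2 = v).card : ℝ) ≤ 9 * (c1 / (c0 * Creg ^ 3)) := by
  have hsub : (M.edges.filter fun σ => σ.1 = v ∨ σ.2 = v) ⊆
      (M.tris.filter fun t => v ∈ Set.range t.vtx).biUnion fun t => M.edges.filter fun σ => t.hasEdge σ := by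
    intro σ hσ
    obtain ⟨hσ, hv⟩ := Finset.mem_filter.mp hσ
    obtain ⟨hK, hE⟩ := M.Kof_mem σ hσ
    refine Finset.mem_biUnion.mpr ⟨M.Kof σ, Finset.mem_filter.mpr ⟨hK, ?_⟩, Finset.mem_filter.mpr ⟨hσ, hE⟩⟩
    rcases hv with rfl | rfl
    · exact hE.2.1
    · exact hE.2.2
  have h1 := (Finset.card_le_card hsub).trans
    (Finset.card_biUnion_le_card_mul _ _ 9 fun t _ => M.edges_tri_card t)
  have h2 := M.tri_degree hC hM v
  have h3 : ((M.edges.filter fun σ => σ.1 = v ∨ σ.2 = v).card : ℝ) ≤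
    ((M.tris.filter fun t => v ∈ Set.range t.vtx).card : ℝ) * 9 := by exact_mod_cast h1
  linarith

variable {u : Tri → (E2 →ᵃ[ℝ] E2)}

lemma l2_sq (hu : M.IsRT0 u) (hdiv : ∀ t ∈ M.tris, divA (u t) = 0) :
    M.l2normRT u ^ 2 = ∑ t ∈ M.tris, t.area * ‖u t 0‖ ^ 2 := by
  have h : ∑ t ∈ M.tris, ∫ x in t.carrier, ‖u t x‖ ^ 2 = ∑ t ∈ M.tris, t.area * ‖u t 0‖ ^ 2 := by
    refine Finset.sum_congr rfl fun t ht => ?_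
    simp_rw [fun x => M.rt_const hu hdiv ht x 0]
    rw [setIntegral_const, smul_eq_mul]; rfl
  unfold l2normRT
  rw [h, Real.sq_sqrt]
  exact Finset.sum_nonneg fun t _ => mul_nonneg t.area_pos.le (sq_nonneg _)

lemma flx_sq (hC : 0 < Creg) (hM : M.Regular Creg) {σ : E2 × E2} (hσ : σ ∈ M.edges) :
    M.flx u σ ^ 2 ≤ (M.Kof σ).area * ‖u (M.Kof σ) 0‖ ^ 2 / (c0 * Creg ^ 3) := by
  have hk : 0 < c0 * Creg ^ 3 := mul_pos c0_pos (pow_pos hC 3)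
  have h1 : |M.flx u σ| ≤ ‖u (M.Kof σ) 0‖ * M.meshSize := by
    refine (abs_real_inner_le_norm _ _).trans ?_
    rw [norm_perp, ← dist_eq_norm, dist_comm]
    exact mul_le_mul_of_nonneg_left (M.elen_le hσ) (norm_nonneg _)
  have h2 := pow_le_pow_left₀ (abs_nonneg _) h1 2
  rw [sq_abs] at h2
  rw [le_div_iff₀ hk]
  have h3 := (M.le_vol hC hM (M.Kof_mem σ hσ).1).trans (M.Kof σ).vol_area
  have h4 := mul_le_mul_of_nonneg_right h3 (sq_nonneg ‖u (M.Kof σ) 0‖)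
  have h5 := mul_le_mul_of_nonneg_right h2 hk.le
  refine h5.trans (le_trans (le_of_eq ?_) h4)
  ring

lemma flx_sum_sq (hu : M.IsRT0 u) (hdiv : ∀ t ∈ M.tris, divA (u t) = 0)
    (hC : 0 < Creg) (hM : M.Regular Creg) :
    ∑ σ ∈ M.edges, M.flx u σ ^ 2 ≤ 9 / (c0 * Creg ^ 3) * M.l2normRT u ^ 2 := by
  have hk : 0 < c0 * Creg ^ 3 := mul_pos c0_pos (pow_pos hC 3)
  set g : Tri → ℝ := fun t => t.area * ‖u t 0‖ ^ 2 / (c0 * Creg ^ 3) with hg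
  have hg0 : ∀ t, 0 ≤ g t := fun t => div_nonneg (mul_nonneg t.area_pos.le (sq_nonneg _)) hk.le
  calc ∑ σ ∈ M.edges, M.flx u σ ^ 2 ≤ ∑ σ ∈ M.edges, g (M.Kof σ) :=
        Finset.sum_le_sum fun σ hσ => M.flx_sq hC hM hσ
    _ ≤ ∑ σ ∈ M.edges, ∑ t ∈ M.tris, if t.hasEdge σ then g t else 0 := by
        refine Finset.sum_le_sum fun σ hσ => ?_
        obtain ⟨hK, hE⟩ := M.Kof_mem σ hσ
        refine le_trans ?_ (Finset.single_le_sum (f := fun t : Tri => if t.hasEdge σ then g t else 0) ?_ hK)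
        · simp [hE]
        · intro t _
          split_ifs
          · exact hg0 t
          · exact le_rfl
    _ = ∑ t ∈ M.tris, ∑ σ ∈ M.edges, if t.hasEdge σ then g t else 0 := Finset.sum_comm
    _ ≤ ∑ t ∈ M.tris, 9 * g t := by
        refine Finset.sum_le_sum fun t _ => ?_
        rw [← Finset.sum_filter, Finset.sum_const, nsmul_eq_mul]
        exact mul_le_mul_of_nonneg_right (by exact_mod_cast M.edges_tri_card t) (hg0 t)
    _ = _ := by
        rw [M.l2_sq hu hdiv, Finset.mul_sum]
        refine Finset.sum_congr rfl fun t _ => ?_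
        simp only [hg]; ring

end Mesh

/-! ### Part 9 -/



lemma abs_cs {ι : Type*} (E : Finset ι) (f g : ι → ℝ) :
    (∑ σ ∈ E, |f σ| * |g σ|) ^ 2 ≤ (∑ σ ∈ E, f σ ^ 2) * ∑ σ ∈ E, g σ ^ 2 := by
  have h := Finset.sum_mul_sq_le_sq_mul_sq E (fun σ => |f σ|) (fun σ => |g σ|)
  simpa only [sq_abs] using h

lemma vertex_sum {ι V : Type*} (E : Finset ι) (a b : ι → V) (Vs : Finset V) (D : ℝ)
    (hD : ∀ v, ((E.filter fun σ => a σ = v ∨ b σ = v).card : ℝ) ≤ D) (g : ι → ℝ) :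
    ∑ v ∈ Vs, (∑ σ ∈ E with a σ = v ∨ b σ = v, |g σ|) ^ 2 ≤ D * (2 * ∑ σ ∈ E, g σ ^ 2) := by
  have h1 : ∀ v ∈ Vs, (∑ σ ∈ E with a σ = v ∨ b σ = v, |g σ|) ^ 2 ≤
      D * ∑ σ ∈ E with a σ = v ∨ b σ = v, g σ ^ 2 := by
    intro v _
    have h := sq_sum_le_card_mul_sum_sq (s := E.filter fun σ => a σ = v ∨ b σ = v) (f := fun σ => |g σ|)
    simp only [sq_abs] at h
    exact h.trans (mul_le_mul_of_nonneg_right (hD v) (Finset.sum_nonneg fun _ _ => sq_nonneg _))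
  refine (Finset.sum_le_sum h1).trans ?_
  by_cases hE : ∃ v : V, True
  swap
  · have hVs : Vs = ∅ := Finset.eq_empty_of_forall_notMem fun v _ => hE ⟨v, trivial⟩
    have hE' : E = ∅ := Finset.eq_empty_of_forall_notMem fun σ _ => hE ⟨a σ, trivial⟩
    simp [hVs, hE']
  obtain ⟨v0, -⟩ := hE
  have hD0 : 0 ≤ D := (Nat.cast_nonneg _).trans (hD v0)
  rw [← Finset.mul_sum]
  refine mul_le_mul_of_nonneg_left ?_ hD0
  simp_rw [Finset.sum_filter]
  rw [Finset.sum_comm, Finset.mul_sum]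
  refine Finset.sum_le_sum fun σ _ => ?_
  rw [← Finset.sum_filter, Finset.sum_const, nsmul_eq_mul]
  refine mul_le_mul_of_nonneg_right ?_ (sq_nonneg _)
  have : (Vs.filter fun v => a σ = v ∨ b σ = v) ⊆ {a σ, b σ} := by
    intro v hv
    rcases (Finset.mem_filter.mp hv).2 with h | h <;> simp [h]
  exact_mod_cast (Finset.card_le_card this).trans Finset.card_le_two

lemma comp_bound {ι V T : Type*} (E : Finset ι) (a b : ι → V) (k l : ι → T) 
    (H : ∀ (φ : V → ℝ) (h : T → ℝ), ∑ σ ∈ E, (φ (b σ) - φ (a σ)) * (h (l σ) - h (k σ)) = 0)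
    (D : ℝ) (hD0 : 0 ≤ D) (hD : ∀ v, ((E.filter fun σ => a σ = v ∨ b σ = v).card : ℝ) ≤ D)
    (ψ : V → ℝ) (x y : T → ℝ) :
    (∑ σ ∈ E, (ψ (b σ) - ψ (a σ)) * (x (k σ) * y (l σ) - x (l σ) * y (k σ))) ^ 2 ≤
      8 * D * (∑ σ ∈ E, (ψ (b σ) - ψ (a σ)) ^ 2) * (∑ σ ∈ E, (x (l σ) - x (k σ)) ^ 2) *
        ∑ σ ∈ E, (y (l σ) - y (k σ)) ^ 2 := by
  set Vs : Finset V := E.image a ∪ E.image b with hVs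
  have h := abstract_bound E a b k l Vs
    (fun σ hσ => Finset.mem_union_left _ (Finset.mem_image_of_mem a hσ))
    (fun σ hσ => Finset.mem_union_right _ (Finset.mem_image_of_mem b hσ)) H ψ x y
  set Z := (∑ σ ∈ E, (ψ (b σ) - ψ (a σ)) * (x (k σ) * y (l σ) - x (l σ) * y (k σ))) ^ 2
  have c2 := abs_cs E (fun σ => ψ (b σ) - ψ (a σ)) (fun σ => y (l σ) - y (k σ))
  have c3 := abs_cs E (fun σ => ψ (b σ) - ψ (a σ)) (fun σ => x (l σ) - x (k σ))
  have c1 := Finset.sum_mul_sq_le_sq_mul_sq Vs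
    (fun v => ∑ σ ∈ E with a σ = v ∨ b σ = v, |y (l σ) - y (k σ)|)
    (fun v => ∑ σ ∈ E with a σ = v ∨ b σ = v, |x (l σ) - x (k σ)|)
  have d1 := vertex_sum E a b Vs D hD (fun σ => y (l σ) - y (k σ))
  have d2 := vertex_sum E a b Vs D hD (fun σ => x (l σ) - x (k σ))
  set Φ := ∑ σ ∈ E, (ψ (b σ) - ψ (a σ)) ^ 2
  set X := ∑ σ ∈ E, (x (l σ) - x (k σ)) ^ 2
  set Y := ∑ σ ∈ E, (y (l σ) - y (k σ)) ^ 2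
  set A1 := ∑ v ∈ Vs, (∑ σ ∈ E with a σ = v ∨ b σ = v, |y (l σ) - y (k σ)|) *
    (∑ σ ∈ E with a σ = v ∨ b σ = v, |x (l σ) - x (k σ)|)
  set A2 := ∑ σ ∈ E, |ψ (b σ) - ψ (a σ)| * |y (l σ) - y (k σ)|
  set A3 := ∑ σ ∈ E, |ψ (b σ) - ψ (a σ)| * |x (l σ) - x (k σ)|
  have hΦ : 0 ≤ Φ := Finset.sum_nonneg fun _ _ => sq_nonneg _
  have hX : 0 ≤ X := Finset.sum_nonneg fun _ _ => sq_nonneg _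
  have hY : 0 ≤ Y := Finset.sum_nonneg fun _ _ => sq_nonneg _
  have hZ : 0 ≤ Z := sq_nonneg _
  have e1 : A1 ^ 2 ≤ (D * (2 * Y)) * (D * (2 * X)) :=
    c1.trans (mul_le_mul d1 d2 (Finset.sum_nonneg fun _ _ => sq_nonneg _) (by positivity))
  refine (sq_le_sq₀ hZ (by positivity)).mp ?_
  calc Z ^ 2 ≤ (4 * (A2 * (A3 * A1))) ^ 2 := pow_le_pow_left₀ hZ h 2
    _ = 16 * (A2 ^ 2 * (A3 ^ 2 * A1 ^ 2)) := by ring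
    _ ≤ 16 * ((Φ * Y) * ((Φ * X) * ((D * (2 * Y)) * (D * (2 * X))))) := by gcongr
    _ = 64 * (D * Φ * X * Y) ^ 2 := by ring
    _ = _ := by ring

namespace Mesh

variable {Ω : Set E2} (M : Mesh Ω)

/-- The neighbour across an edge, `none` outside the domain. -/
def Lo (σ : E2 × E2) : Option Tri := if σ ∈ M.intEdges then some (M.Lof σ) else none

/-- Left side of an edge. -/
def lft (σ : E2 × E2) : Option Tri := if (M.Kof σ).sgn σ = 1 then some (M.Kof σ) else M.Lo σ

/-- Right side of an edge. -/
def rgt (σ : E2 × E2) : Option Tri := if (M.Kof σ).sgn σ = 1 then M.Lo σ else some (M.Kof σ)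

/-- Extension by zero. -/
def ez {W : Type*} [Zero W] (z : Tri → W) : Option Tri → W
  | some t => z t
  | none => 0

@[simp] lemma ez_some {W : Type*} [Zero W] (z : Tri → W) (t : Tri) : ez z (some t) = z t := rfl
@[simp] lemma ez_none {W : Type*} [Zero W] (z : Tri → W) : ez z none = 0 := rfl

lemma Lo_int {σ : E2 × E2} (hσ : σ ∈ M.intEdges) : M.Lo σ = some (M.Lof σ) := if_pos hσ
lemma Lo_ext {σ : E2 × E2} (hσ : σ ∈ M.extEdges) : M.Lo σ = none :=
  if_neg fun h => Finset.disjoint_left.mp M.int_ext_disj h hσ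

lemma sgn_cases {t : Tri} {σ : E2 × E2} (h : t.hasEdge σ) : t.sgn σ = 1 ∨ t.sgn σ = -1 :=
  mul_self_eq_one_iff.mp (t.sgn_sq h)

lemma sides {σ : E2 × E2} (hσ : σ ∈ M.edges) :
    ((M.Kof σ).sgn σ = 1 ∧ M.lft σ = some (M.Kof σ) ∧ M.rgt σ = M.Lo σ) ∨
    ((M.Kof σ).sgn σ = -1 ∧ M.lft σ = M.Lo σ ∧ M.rgt σ = some (M.Kof σ)) := by
  rcases sgn_cases (M.Kof_mem σ hσ).2 with h | h
  · left; simp [lft, rgt, h]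
  · right
    have : (M.Kof σ).sgn σ ≠ 1 := by rw [h]; norm_num
    simp only [lft, rgt, if_neg this]
    simp [h]

lemma jump_eq {σ : E2 × E2} (hσ : σ ∈ M.edges) (h : Option Tri → ℝ) :
    h (M.lft σ) - h (M.rgt σ) = ∑ t ∈ M.tris, t.sgn σ * (h (some t) - h none) := by
  rcases M.int_or_ext hσ with h1 | h1
  · rw [M.sum_tris_int h1, M.sgn_L h1]
    rcases M.sides hσ with ⟨a, b, c⟩ | ⟨a, b, c⟩ <;> rw [a, b, c, M.Lo_int h1] <;> ring
  · rw [M.sum_tris_ext h1]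
    rcases M.sides hσ with ⟨a, b, c⟩ | ⟨a, b, c⟩ <;> rw [a, b, c, M.Lo_ext h1] <;> ring

lemma orth (φ : E2 → ℝ) (h : Option Tri → ℝ) :
    ∑ σ ∈ M.edges, (φ σ.2 - φ σ.1) * (h (M.lft σ) - h (M.rgt σ)) = 0 := by
  have h1 : ∀ σ ∈ M.edges, (φ σ.2 - φ σ.1) * (h (M.lft σ) - h (M.rgt σ)) =
      ∑ t ∈ M.tris, (h (some t) - h none) * (t.sgn σ * (φ σ.2 - φ σ.1)) := by
    intro σ hσ
    rw [M.jump_eq hσ, Finset.mul_sum]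
    exact Finset.sum_congr rfl fun t _ => by ring
  rw [Finset.sum_congr rfl h1, Finset.sum_comm]
  refine Finset.sum_eq_zero fun t ht => ?_
  rw [← Finset.mul_sum, M.tri_cycle ht, mul_zero]

lemma jump_sq {Creg : ℝ} (hC : 0 < Creg) (hM : M.Regular Creg) (z : Tri → E2) :
    ∑ σ ∈ M.edges, ‖ez z (M.lft σ) - ez z (M.rgt σ)‖ ^ 2 ≤ M.normh z ^ 2 / Creg := by
  have hn : M.normh z ^ 2 = ∑ σ ∈ M.intEdges, M.tau σ * ‖z (M.Lof σ) - z (M.Kof σ)‖ ^ 2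
      + ∑ σ ∈ M.extEdges, M.tau σ * ‖z (M.Kof σ)‖ ^ 2 := by
    unfold normh
    rw [Real.sq_sqrt]
    refine add_nonneg (Finset.sum_nonneg fun σ hσ => ?_) (Finset.sum_nonneg fun σ hσ => ?_)
    · exact mul_nonneg (hC.le.trans (M.le_tau hC hM (M.edges_of_int hσ))) (sq_nonneg _)
    · exact mul_nonneg (hC.le.trans (M.le_tau hC hM (M.edges_of_ext hσ))) (sq_nonneg _)
  rw [le_div_iff₀ hC, hn, ← M.union_edges, Finset.sum_union M.int_ext_disj, add_mul,
    Finset.sum_mul, Finset.sum_mul]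
  refine add_le_add (Finset.sum_le_sum fun σ hσ => ?_) (Finset.sum_le_sum fun σ hσ => ?_)
  · have hE := M.edges_of_int hσ
    have : ‖ez z (M.lft σ) - ez z (M.rgt σ)‖ = ‖z (M.Lof σ) - z (M.Kof σ)‖ := by
      rcases M.sides hE with ⟨a, b, c⟩ | ⟨a, b, c⟩ <;> rw [b, c, M.Lo_int hσ]
      · simp [norm_sub_rev]
      · simp
    rw [this, mul_comm]
    exact mul_le_mul_of_nonneg_right (M.le_tau hC hM hE) (sq_nonneg _)
  · have hE := M.edges_of_ext hσ
    have : ‖ez z (M.lft σ) - ez z (M.rgt σ)‖ = ‖z (M.Kof σ)‖ := by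
      rcases M.sides hE with ⟨a, b, c⟩ | ⟨a, b, c⟩ <;> rw [b, c, M.Lo_ext hσ] <;> simp
    rw [this, mul_comm]
    exact mul_le_mul_of_nonneg_right (M.le_tau hC hM hE) (sq_nonneg _)

variable {u : Tri → (E2 →ᵃ[ℝ] E2)}

/-- The contribution of one triangle and one edge to the trilinear form. -/
def ctr (u : Tri → (E2 →ᵃ[ℝ] E2)) (v w : Tri → E2) (t : Tri) (σ : E2 × E2) : ℝ :=
  elen σ * (max (unrm u t σ) 0 * ⟪w t, v t⟫ + min (unrm u t σ) 0 * ⟪w t, v (M.other t σ)⟫)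

lemma bh_eq (v w : Tri → E2) :
    M.bh u v w = ∑ σ ∈ M.intEdges, (M.ctr u v w (M.Kof σ) σ + M.ctr u v w (M.Lof σ) σ) := by
  have h1 : ∀ t ∈ M.tris, t.area * ⟪w t, M.btilde u v t⟫ =
      ∑ σ ∈ M.intEdges, if t.hasEdge σ then M.ctr u v w t σ else 0 := by
    intro t _
    unfold btilde
    rw [inner_smul_right, mul_inv_cancel_left₀ t.area_pos.ne', inner_sum, Finset.sum_filter]
    refine Finset.sum_congr rfl fun σ _ => ?_
    split_ifs
    · rw [inner_smul_right, inner_add_right, inner_smul_right, inner_smul_right]; rfl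
    · rfl
  unfold bh
  rw [Finset.sum_congr rfl h1, Finset.sum_comm]
  refine Finset.sum_congr rfl fun σ hσ => ?_
  rw [← Finset.sum_filter, M.filter_int hσ, Finset.sum_pair (M.L_ne hσ).symm]

lemma ctr_eq (hu : M.IsRT0 u) (hdiv : ∀ t ∈ M.tris, divA (u t) = 0) (v w : Tri → E2)
    {σ : E2 × E2} (hσ : σ ∈ M.intEdges) :
    M.ctr u v w (M.Kof σ) σ + M.ctr u v w (M.Lof σ) σ =
      (1 / 2) * (|M.flx u σ| * ⟪ez w (M.lft σ) - ez w (M.rgt σ), ez v (M.lft σ) - ez v (M.rgt σ)⟫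
        + M.flx u σ * (⟪ez w (M.rgt σ), ez v (M.lft σ)⟫ - ⟪ez w (M.lft σ), ez v (M.rgt σ)⟫)
        - M.flx u σ * (ez (fun t => ⟪w t, v t⟫) (M.lft σ) - ez (fun t => ⟪w t, v t⟫) (M.rgt σ))) := by
  have hE := M.edges_of_int hσ
  have hlen := M.elen_pos hE
  have hK := M.unrm_K hu hdiv hE
  have hL := M.unrm_eq hu hdiv (M.L_mem hσ) hE (M.L_edge hσ)
  rw [M.flx_L hu hdiv hσ, M.sgn_L hσ] at hL
  have hmx : ∀ a : ℝ, elen σ * max a 0 = max (elen σ * a) 0 := fun a => by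
    rw [mul_max_of_nonneg _ _ hlen.le, mul_zero]
  have hmn : ∀ a : ℝ, elen σ * min a 0 = min (elen σ * a) 0 := fun a => by
    rw [mul_min_of_nonneg _ _ hlen.le, mul_zero]
  unfold ctr other
  rw [if_pos rfl, if_neg (M.L_ne hσ).symm, mul_add, mul_add, ← mul_assoc, ← mul_assoc, ← mul_assoc,
    ← mul_assoc, hmx, hmn, hmx, hmn, hK, hL]
  have hmax : ∀ a : ℝ, max a 0 = (|a| + a) / 2 := fun a => by
    rcases le_total 0 a with h | h
    · rw [max_eq_left h, abs_of_nonneg h]; ring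
    · rw [max_eq_right h, abs_of_nonpos h]; ring
  have hmin : ∀ a : ℝ, min a 0 = (a - |a|) / 2 := fun a => by
    rcases le_total 0 a with h | h
    · rw [min_eq_right h, abs_of_nonneg h]; ring
    · rw [min_eq_left h, abs_of_nonpos h]; ring
  rw [hmax, hmin, hmax, hmin]
  rcases M.sides hE with ⟨a, b, c⟩ | ⟨a, b, c⟩
  · rw [a, b, c, M.Lo_int hσ]
    simp only [ez_some, inner_sub_left, inner_sub_right, one_mul, neg_mul, neg_neg, abs_neg]
    ring
  · rw [a, b, c, M.Lo_int hσ]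
    simp only [ez_some, inner_sub_left, inner_sub_right, one_mul, neg_mul, neg_neg, abs_neg]
    ring

lemma bh_eq2 (hu : M.IsRT0 u) (hdiv : ∀ t ∈ M.tris, divA (u t) = 0) (v w : Tri → E2) :
    M.bh u v w = (1 / 2) * (∑ σ ∈ M.edges,
        |M.flx u σ| * ⟪ez w (M.lft σ) - ez w (M.rgt σ), ez v (M.lft σ) - ez v (M.rgt σ)⟫
      + ∑ σ ∈ M.edges,
        M.flx u σ * (⟪ez w (M.rgt σ), ez v (M.lft σ)⟫ - ⟪ez w (M.lft σ), ez v (M.rgt σ)⟫)) := by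
  obtain ⟨ψ, hψ⟩ := M.flx_stream hu hdiv
  have h0 : ∑ σ ∈ M.edges, M.flx u σ *
      (ez (fun t => ⟪w t, v t⟫) (M.lft σ) - ez (fun t => ⟪w t, v t⟫) (M.rgt σ)) = 0 := by
    rw [← M.orth ψ (ez fun t => ⟪w t, v t⟫)]
    exact Finset.sum_congr rfl fun σ hσ => by rw [hψ σ hσ]
  rw [M.bh_eq, Finset.sum_congr rfl fun σ hσ => M.ctr_eq hu hdiv v w hσ]
  have hsub : M.intEdges ⊆ M.edges := fun σ hσ => M.edges_of_int hσ
  rw [Finset.sum_subset hsub, ← Finset.mul_sum, Finset.sum_sub_distrib, Finset.sum_add_distrib, h0, sub_zero]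
  intro σ hσ hn
  have := (M.int_or_ext hσ).resolve_left hn
  rw [M.flx_ext hu hdiv this]; simp

end Mesh

lemma Mesh.bh_bound {Ω : Set E2} (M : Mesh Ω) {u : Tri → (E2 →ᵃ[ℝ] E2)} (hu : M.IsRT0 u)
    (hdiv : ∀ t ∈ M.tris, divA (u t) = 0) (v w : Tri → E2) {D P V W : ℝ} (hD0 : 0 ≤ D)
    (hD : ∀ p : E2, ((M.edges.filter fun σ => σ.1 = p ∨ σ.2 = p).card : ℝ) ≤ D)
    (hP0 : 0 ≤ P) (hV0 : 0 ≤ V) (hW0 : 0 ≤ W)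
    (hP : ∑ σ ∈ M.edges, M.flx u σ ^ 2 ≤ P ^ 2)
    (hV : ∑ σ ∈ M.edges, ‖Mesh.ez v (M.lft σ) - Mesh.ez v (M.rgt σ)‖ ^ 2 ≤ V ^ 2)
    (hW : ∑ σ ∈ M.edges, ‖Mesh.ez w (M.lft σ) - Mesh.ez w (M.rgt σ)‖ ^ 2 ≤ W ^ 2) :
    |M.bh u v w| ≤ (1 / 2 + Real.sqrt (8 * D)) * (P * V * W) := by
  obtain ⟨ψ, hψ⟩ := M.flx_stream hu hdiv
  have hs0 := Real.sqrt_nonneg (8 * D)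
  have hss := Real.sq_sqrt (show 0 ≤ 8 * D by linarith)
  -- the diffusive part
  have t1 : |∑ σ ∈ M.edges, |M.flx u σ| * ⟪Mesh.ez w (M.lft σ) - Mesh.ez w (M.rgt σ),
      Mesh.ez v (M.lft σ) - Mesh.ez v (M.rgt σ)⟫| ≤ P * V * W := by
    have hcs : ∑ σ ∈ M.edges, ‖Mesh.ez w (M.lft σ) - Mesh.ez w (M.rgt σ)‖ *
        ‖Mesh.ez v (M.lft σ) - Mesh.ez v (M.rgt σ)‖ ≤ W * V := by
      refine abs_le_of_sq_le_sq' ?_ (mul_nonneg hW0 hV0) |>.2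
      refine (Finset.sum_mul_sq_le_sq_mul_sq _ _ _).trans ?_
      rw [mul_pow]
      exact mul_le_mul hW hV (Finset.sum_nonneg fun _ _ => sq_nonneg _) (sq_nonneg _)
    refine (Finset.abs_sum_le_sum_abs _ _).trans ?_
    calc _ ≤ ∑ σ ∈ M.edges, P * (‖Mesh.ez w (M.lft σ) - Mesh.ez w (M.rgt σ)‖ *
        ‖Mesh.ez v (M.lft σ) - Mesh.ez v (M.rgt σ)‖) := by
          refine Finset.sum_le_sum fun σ hσ => ?_
          rw [abs_mul, abs_abs]
          have hf : |M.flx u σ| ≤ P := by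
            refine abs_le_of_sq_le_sq ?_ hP0
            exact (Finset.single_le_sum (f := fun σ => M.flx u σ ^ 2) (fun _ _ => sq_nonneg _) hσ).trans hP
          exact mul_le_mul hf (abs_real_inner_le_norm _ _) (abs_nonneg _) hP0
      _ ≤ P * (W * V) := by
          rw [← Finset.mul_sum]
          exact mul_le_mul_of_nonneg_left hcs hP0
      _ = _ := by ring
  -- the antisymmetric part, one component
  have t2 : ∀ i : Fin 2, |∑ σ ∈ M.edges, M.flx u σ *
      (Mesh.ez w (M.rgt σ) i * Mesh.ez v (M.lft σ) i - Mesh.ez w (M.lft σ) i * Mesh.ez v (M.rgt σ) i)|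
      ≤ Real.sqrt (8 * D) * (P * V * W) := by
    intro i
    have hb := comp_bound M.edges Prod.fst Prod.snd M.rgt M.lft M.orth D hD0 (fun p => by convert hD p) ψ
      (fun o => Mesh.ez w o i) (fun o => Mesh.ez v o i)
    have e1 : ∑ σ ∈ M.edges, (ψ σ.2 - ψ σ.1) * (Mesh.ez w (M.rgt σ) i * Mesh.ez v (M.lft σ) i
        - Mesh.ez w (M.lft σ) i * Mesh.ez v (M.rgt σ) i) = ∑ σ ∈ M.edges, M.flx u σ *
      (Mesh.ez w (M.rgt σ) i * Mesh.ez v (M.lft σ) i - Mesh.ez w (M.lft σ) i * Mesh.ez v (M.rgt σ) i) :=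
      Finset.sum_congr rfl fun σ hσ => by rw [hψ σ hσ]
    have e2 : ∑ σ ∈ M.edges, (ψ σ.2 - ψ σ.1) ^ 2 = ∑ σ ∈ M.edges, M.flx u σ ^ 2 :=
      Finset.sum_congr rfl fun σ hσ => by rw [hψ σ hσ]
    have e3 : ∀ z : Tri → E2, ∑ σ ∈ M.edges, (Mesh.ez z (M.lft σ) i - Mesh.ez z (M.rgt σ) i) ^ 2 ≤
        ∑ σ ∈ M.edges, ‖Mesh.ez z (M.lft σ) - Mesh.ez z (M.rgt σ)‖ ^ 2 := by
      intro z
      refine Finset.sum_le_sum fun σ _ => ?_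
      have h := abs_coord_le (Mesh.ez z (M.lft σ) - Mesh.ez z (M.rgt σ)) i
      rw [PiLp.sub_apply] at h
      have h2 := pow_le_pow_left₀ (abs_nonneg _) h 2
      rwa [sq_abs] at h2
    rw [e1, e2] at hb
    refine abs_le_of_sq_le_sq (hb.trans ?_) (by positivity)
    have f1 := (e3 w).trans hW
    have f2 := (e3 v).trans hV
    have g0 : 0 ≤ ∑ σ ∈ M.edges, M.flx u σ ^ 2 := Finset.sum_nonneg fun _ _ => sq_nonneg _
    have g1 : 0 ≤ ∑ σ ∈ M.edges, (Mesh.ez w (M.lft σ) i - Mesh.ez w (M.rgt σ) i) ^ 2 :=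
      Finset.sum_nonneg fun _ _ => sq_nonneg _
    have g2 : 0 ≤ ∑ σ ∈ M.edges, (Mesh.ez v (M.lft σ) i - Mesh.ez v (M.rgt σ) i) ^ 2 :=
      Finset.sum_nonneg fun _ _ => sq_nonneg _
    calc _ ≤ 8 * D * P ^ 2 * W ^ 2 * V ^ 2 := by gcongr
      _ = _ := by rw [mul_pow, hss]; ring
  have t3 : ∑ σ ∈ M.edges, M.flx u σ *
      (⟪Mesh.ez w (M.rgt σ), Mesh.ez v (M.lft σ)⟫ - ⟪Mesh.ez w (M.lft σ), Mesh.ez v (M.rgt σ)⟫) =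
      ∑ σ ∈ M.edges, M.flx u σ *
      (Mesh.ez w (M.rgt σ) 0 * Mesh.ez v (M.lft σ) 0 - Mesh.ez w (M.lft σ) 0 * Mesh.ez v (M.rgt σ) 0) +
      ∑ σ ∈ M.edges, M.flx u σ *
      (Mesh.ez w (M.rgt σ) 1 * Mesh.ez v (M.lft σ) 1 - Mesh.ez w (M.lft σ) 1 * Mesh.ez v (M.rgt σ) 1) := by
    rw [← Finset.sum_add_distrib]
    refine Finset.sum_congr rfl fun σ _ => ?_
    rw [inner_E2, inner_E2]; ring
  rw [M.bh_eq2 hu hdiv, t3]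
  have a1 := abs_le.mp t1
  have a2 := abs_le.mp (t2 0)
  have a3 := abs_le.mp (t2 1)
  rw [abs_le]
  constructor <;> linarith [a1.1, a1.2, a2.1, a2.2, a3.1, a3.2]

/-- **Stability of the upwind convection operator**: there exists `C > 0` depending only
on `Ω` and the regularity constant `C_reg` such that for every admissible regular mesh,
every discretely divergence-free `u_h ∈ RT₀` and all `v_h, w_h ∈ P₀`,
`|b_h(u_h, v_h, w_h)| ≤ C |u_h| ‖v_h‖_h ‖w_h‖_h`. -/
theorem upwind_convection_stability
    {Ω : Set E2} (hΩo : IsOpen Ω) (hΩc : IsConnected Ω) (hΩb : Bornology.IsBounded Ω)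
    (Creg : ℝ) (hCreg : 0 < Creg) :
    ∃ C > 0, ∀ M : Mesh Ω, M.Regular Creg →
      ∀ u : Tri → (E2 →ᵃ[ℝ] E2), M.IsRT0 u → (∀ t ∈ M.tris, divA (u t) = 0) →
      ∀ v w : Tri → E2,
        |M.bh u v w| ≤ C * M.l2normRT u * M.normh v * M.normh w := by
  have hk : 0 < c0 * Creg ^ 3 := mul_pos c0_pos (pow_pos hCreg 3)
  have hD0 : 0 ≤ 9 * (c1 / (c0 * Creg ^ 3)) :=
    mul_nonneg (by norm_num) (div_nonneg ENNReal.toReal_nonneg hk.le)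
  have h9 : 0 < 9 / (c0 * Creg ^ 3) := div_pos (by norm_num) hk
  have hsC := Real.sqrt_pos.mpr hCreg
  refine ⟨(1 / 2 + Real.sqrt (8 * (9 * (c1 / (c0 * Creg ^ 3))))) *
    (Real.sqrt (9 / (c0 * Creg ^ 3)) / Creg), ?_, ?_⟩
  · have := Real.sqrt_pos.mpr h9
    positivity
  intro M hM u hu hdiv v w
  have hl : 0 ≤ M.l2normRT u := Real.sqrt_nonneg _
  have hv : 0 ≤ M.normh v := Real.sqrt_nonneg _
  have hw : 0 ≤ M.normh w := Real.sqrt_nonneg _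
  have hb := M.bh_bound hu hdiv v w (D := 9 * (c1 / (c0 * Creg ^ 3)))
    (P := Real.sqrt (9 / (c0 * Creg ^ 3)) * M.l2normRT u)
    (V := M.normh v / Real.sqrt Creg) (W := M.normh w / Real.sqrt Creg) hD0
    (fun p => M.edge_degree hCreg hM p) (mul_nonneg (Real.sqrt_nonneg _) hl)
    (div_nonneg hv hsC.le) (div_nonneg hw hsC.le)
    (by rw [mul_pow, Real.sq_sqrt h9.le]; exact M.flx_sum_sq hu hdiv hCreg hM)
    (by rw [div_pow, Real.sq_sqrt hCreg.le]; exact M.jump_sq hCreg hM v)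
    (by rw [div_pow, Real.sq_sqrt hCreg.le]; exact M.jump_sq hCreg hM w)
  refine hb.trans (le_of_eq ?_)
  have e : ∀ a b : ℝ, a / Real.sqrt Creg * (b / Real.sqrt Creg) = a * b / Creg := fun a b => by
    rw [div_mul_div_comm, Real.mul_self_sqrt hCreg.le]
  rw [mul_assoc _ (M.normh v / _), e]
  ring

end
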